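/- arXiv:2307.03283 — 3 statements merged into one kernel-verified Lean document; each statement's English description precedes it below -/
import Mathlib

section
/- (Theorem 23 of Baspin–Krishna via the framework) Let β ≥ 1 and c ∈ (0,1). There is a constant α = α(β,c) such that any ⟦n,k,d⟧ stabilizer code whose connectivity graph G satisfies s_G(r) ≤ β·r^c for all r obeys k·d^{2(1−c)} ≤ α·n. -/
open scoped Classical ComplexOrder
open Finset

/-- Outer boundary: vertices outside `U` adjacent to some vertex of `U`. -/
noncomputable def outerBoundary {V : Type*} [Fintype V] (G : SimpleGraph V) (U : Finset V) :
    Finset V :=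
  Finset.univ.filter fun v => v ∉ U ∧ ∃ u ∈ U, G.Adj u v

/-- Inner boundary: vertices of `U` adjacent to some vertex outside `U`. -/
noncomputable def innerBoundary {V : Type*} [Fintype V] (G : SimpleGraph V) (U : Finset V) :
    Finset V :=
  Finset.univ.filter fun u => u ∈ U ∧ ∃ v, v ∉ U ∧ G.Adj u v

/-- Two vertex sets are disconnected: no edge of `G` joins them. -/
def Disconn {V : Type*} (G : SimpleGraph V) (A B : Finset V) : Prop :=
  ∀ a ∈ A, ∀ b ∈ B, ¬ G.Adj a b

/-- A `d`-correctable family of a graph `G`: closed under subsets (Trivial), contains all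
sets of size `< d` (Distance), closed under unions of pairwise disjoint pairwise
disconnected members (Union), and closed under expansion (Expansion). -/
def IsCorrectableFamily {V : Type*} [Fintype V] [DecidableEq V] (G : SimpleGraph V) (d : ℕ)
    (F : Set (Finset V)) : Prop :=
  (∀ U ∈ F, ∀ W ⊆ U, W ∈ F) ∧
  (∀ U : Finset V, U.card < d → U ∈ F) ∧
  (∀ (ℓ : ℕ) (U : Fin ℓ → Finset V), (∀ i, U i ∈ F) →
    (∀ i j, i ≠ j → Disjoint (U i) (U j) ∧ Disconn G (U i) (U j)) →
    Finset.univ.biUnion U ∈ F) ∧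
  (∀ U ∈ F, ∀ T ∈ F, outerBoundary G U ⊆ T → U ∪ T ∈ F)

/-- A set is `d`-correctable with respect to `G` if it belongs to every
`d`-correctable family of `G`. -/
def IsCorrectableSet {V : Type*} [Fintype V] [DecidableEq V] (G : SimpleGraph V) (d : ℕ)
    (U : Finset V) : Prop :=
  ∀ F : Set (Finset V), IsCorrectableFamily G d F → U ∈ F

/-- The (induced subgraph on) `H` admits a 2/3-balanced separator of size at most `t`. -/
def SepUpTo {V : Type*} [DecidableEq V] (G : SimpleGraph V) (H : Finset V) (t : ℝ) : Prop :=
  ∃ T U₁ U₂ : Finset V, T ∪ U₁ ∪ U₂ = H ∧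
    Disjoint T U₁ ∧ Disjoint T U₂ ∧ Disjoint U₁ U₂ ∧
    Disconn G U₁ U₂ ∧
    3 * U₁.card ≤ 2 * H.card ∧ 3 * U₂.card ≤ 2 * H.card ∧
    (T.card : ℝ) ≤ t

/-- `G` has separation profile `s_G(r) ≤ β · r^c` for all `r`: every vertex subset `H`
admits a 2/3-balanced separator of size at most `β · |H|^c`. -/
def HasSepProfile {V : Type*} [DecidableEq V] (G : SimpleGraph V) (β c : ℝ) : Prop :=
  ∀ H : Finset V, SepUpTo G H (β * (H.card : ℝ) ^ c)

/-- `A` is a union of pairwise disjoint, pairwise disconnected components,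
each of size at most `d - 1`. -/
def SmallComponents {V : Type*} [DecidableEq V] (G : SimpleGraph V) (d : ℕ)
    (A : Finset V) : Prop :=
  ∃ (ℓ : ℕ) (U : Fin ℓ → Finset V), A = Finset.univ.biUnion U ∧
    (∀ i, (U i).card < d) ∧
    ∀ i j, i ≠ j → Disjoint (U i) (U j) ∧ Disconn G (U i) (U j)

/-- Computational-basis index set for `n` qubits. -/
abbrev QIdx (n : ℕ) := Fin n → ZMod 2

/-- The `n`-qubit Pauli operator `X^a Z^b` (as a matrix in the computational basis). -/
noncomputable def pauliXZ {n : ℕ} (a b : QIdx n) : Matrix (QIdx n) (QIdx n) ℂ :=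
  fun f g => if f = g + a then (-1 : ℂ) ^ (∑ i, (b i * g i).val) else 0

/-- Support of the Pauli operator `X^a Z^b`: qubits on which it acts nontrivially. -/
def pauliSupp {n : ℕ} (a b : QIdx n) : Finset (Fin n) :=
  Finset.univ.filter fun i => a i ≠ 0 ∨ b i ≠ 0

/-- A stabilizer code on `n` qubits given by `m` (signed, pairwise commuting) Pauli
generators, the `i`-th generator being `(sign i) · X^{(gen i).1} Z^{(gen i).2}`. -/
structure StabCode (n m : ℕ) where
  gen : Fin m → QIdx n × QIdx n
  sign : Fin m → ℂ
  sign_pm : ∀ i, sign i = 1 ∨ sign i = -1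
  commute : ∀ i j,
    (∑ k, ((gen i).1 k * (gen j).2 k + (gen j).1 k * (gen i).2 k)) = (0 : ZMod 2)

/-- The orthogonal projector onto the code space: `∏ i (I + S_i)/2`. -/
noncomputable def StabCode.proj {n m : ℕ} (S : StabCode n m) :
    Matrix (QIdx n) (QIdx n) ℂ :=
  ((2 : ℂ) ^ m)⁻¹ •
    (List.ofFn fun i : Fin m =>
      (1 : Matrix (QIdx n) (QIdx n) ℂ) + S.sign i • pauliXZ (S.gen i).1 (S.gen i).2).prod

/-- A code state: a density operator supported on the code space. -/
def IsCodeState {n m : ℕ} (S : StabCode n m) (ρ : Matrix (QIdx n) (QIdx n) ℂ) : Prop :=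
  ρ.PosSemidef ∧ ρ.trace = 1 ∧ S.proj * ρ * S.proj = ρ

/-- The code encodes `k` logical qubits: the code space has dimension `2^k`. -/
def HasDim {n m : ℕ} (S : StabCode n m) (k : ℕ) : Prop :=
  S.proj.trace = (2 : ℂ) ^ k

/-- The code has distance at least `d` (Knill–Laflamme conditions for all Pauli
errors of weight `< d`). -/
def HasDistanceGe {n m : ℕ} (S : StabCode n m) (d : ℕ) : Prop :=
  ∀ a b : QIdx n, (pauliSupp a b).card < d →
    ∃ z : ℂ, S.proj * pauliXZ a b * S.proj = z • S.proj

/-- Merge an assignment on the qubits outside `U` with one on `U`. -/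
noncomputable def mergeIdx {n : ℕ} (U : Finset (Fin n)) (f : {i // i ∉ U} → ZMod 2)
    (h : {i // i ∈ U} → ZMod 2) : QIdx n :=
  fun i => if hi : i ∈ U then h ⟨i, hi⟩ else f ⟨i, hi⟩

/-- Partial trace over the qubits in `U`. -/
noncomputable def ptrace {n : ℕ} (U : Finset (Fin n))
    (ρ : Matrix (QIdx n) (QIdx n) ℂ) :
    Matrix ({i // i ∉ U} → ZMod 2) ({i // i ∉ U} → ZMod 2) ℂ :=
  fun f g => ∑ h : ({i // i ∈ U} → ZMod 2), ρ (mergeIdx U f h) (mergeIdx U g h)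

/-- A map on matrices is a quantum channel (CPTP) iff it admits a Kraus representation. -/
def IsCPTP {A B : Type*} [Fintype A] [Fintype B] [DecidableEq A] [DecidableEq B]
    (Φ : Matrix A A ℂ → Matrix B B ℂ) : Prop :=
  ∃ (N : ℕ) (K : Fin N → Matrix B A ℂ),
    (∑ i, (K i).conjTranspose * K i = (1 : Matrix A A ℂ)) ∧
    ∀ ρ, Φ ρ = ∑ i, K i * ρ * (K i).conjTranspose

/-- A set `U` of qubits is correctable: some quantum channel recovers every code state
from its reduced state on the complement of `U`. -/
noncomputable def QCorrectable {n m : ℕ} (S : StabCode n m) (U : Finset (Fin n)) : Prop :=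
  ∃ R : Matrix ({i // i ∉ U} → ZMod 2) ({i // i ∉ U} → ZMod 2) ℂ →
        Matrix (QIdx n) (QIdx n) ℂ,
    IsCPTP R ∧ ∀ ρ, IsCodeState S ρ → R (ptrace U ρ) = ρ

/-- The connectivity graph of a stabilizer code: qubits are connected when they lie in
the support of a common generator. -/
noncomputable def connGraph {n m : ℕ} (S : StabCode n m) : SimpleGraph (Fin n) :=
  SimpleGraph.fromRel fun u v =>
    ∃ i, u ∈ pauliSupp (S.gen i).1 (S.gen i).2 ∧ v ∈ pauliSupp (S.gen i).1 (S.gen i).2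

/-- Phase-space vectors of `n`-qubit Pauli operators: the pair `(a, b)` stands for `X^a Z^b`. -/
abbrev PauliVec (n : ℕ) := QIdx n × QIdx n

/-- The symplectic form on Pauli vectors: it vanishes iff the two operators commute. -/
def symp (n : ℕ) : LinearMap.BilinForm (ZMod 2) (PauliVec n) :=
  LinearMap.mk₂ (ZMod 2) (fun p q => ∑ i, (p.1 i * q.2 i + q.1 i * p.2 i))
    (fun p p' q => by
      simp only [Prod.fst_add, Prod.snd_add, Pi.add_apply, ← Finset.sum_add_distrib]
      exact Finset.sum_congr rfl fun i _ => by ring)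
    (fun c p q => by
      simp only [Prod.smul_fst, Prod.smul_snd, Pi.smul_apply, smul_eq_mul, Finset.mul_sum]
      exact Finset.sum_congr rfl fun i _ => by ring)
    (fun p q q' => by
      simp only [Prod.fst_add, Prod.snd_add, Pi.add_apply, ← Finset.sum_add_distrib]
      exact Finset.sum_congr rfl fun i _ => by ring)
    (fun c p q => by
      simp only [Prod.smul_fst, Prod.smul_snd, Pi.smul_apply, smul_eq_mul, Finset.mul_sum]
      exact Finset.sum_congr rfl fun i _ => by ring)

lemma symp_apply {n : ℕ} (p q : PauliVec n) :
    symp n p q = ∑ i, (p.1 i * q.2 i + q.1 i * p.2 i) := rfl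

lemma symp_comm {n : ℕ} (p q : PauliVec n) : symp n p q = symp n q p := by
  simp only [symp_apply]
  exact Finset.sum_congr rfl fun i _ => by ring

lemma symp_isRefl (n : ℕ) : (symp n).IsRefl := fun p q h => by rw [symp_comm, h]

lemma symp_single_left {n : ℕ} (p : PauliVec n) (i : Fin n) :
    symp n (Pi.single i 1, 0) p = p.2 i := by
  simp [symp_apply, Pi.single_apply]

lemma symp_single_right {n : ℕ} (p : PauliVec n) (i : Fin n) :
    symp n (0, Pi.single i 1) p = p.1 i := by
  simp [symp_apply, Pi.single_apply]

lemma eq_zero_of_symp_eq_zero {n : ℕ} {p : PauliVec n} (h : ∀ q, symp n q p = 0) : p = 0 := by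
  ext i
  · simpa [symp_single_right] using h (0, Pi.single i 1)
  · simpa [symp_single_left] using h (Pi.single i 1, 0)

lemma symp_nondegenerate (n : ℕ) : (symp n).Nondegenerate :=
  ⟨fun _ h => eq_zero_of_symp_eq_zero fun q => by rw [symp_comm, h],
    fun _ h => eq_zero_of_symp_eq_zero h⟩

lemma finrank_pauliVec (n : ℕ) : Module.finrank (ZMod 2) (PauliVec n) = 2 * n := by
  simp [Module.finrank_prod, two_mul]

/-- The Pauli vectors supported inside `U`. -/
def supportedOn {n : ℕ} (U : Finset (Fin n)) : Submodule (ZMod 2) (PauliVec n) where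
  carrier := {p | ∀ i ∉ U, p.1 i = 0 ∧ p.2 i = 0}
  add_mem' hp hq i hi := by simp [hp i hi, hq i hi]
  zero_mem' i _ := by simp
  smul_mem' c p hp i hi := by simp [hp i hi]

lemma mem_supportedOn {n : ℕ} {U : Finset (Fin n)} {p : PauliVec n} :
    p ∈ supportedOn U ↔ ∀ i ∉ U, p.1 i = 0 ∧ p.2 i = 0 := Iff.rfl

lemma supportedOn_mono {n : ℕ} {U W : Finset (Fin n)} (h : U ⊆ W) :
    supportedOn U ≤ supportedOn W := fun _ hp i hi => hp i fun hU => hi (h hU)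

lemma mem_supportedOn_iff_pauliSupp {n : ℕ} {U : Finset (Fin n)} {p : PauliVec n} :
    p ∈ supportedOn U ↔ pauliSupp p.1 p.2 ⊆ U := by
  simp only [mem_supportedOn, Finset.subset_iff, pauliSupp, Finset.mem_filter, Finset.mem_univ,
    true_and]
  refine forall_congr' fun i => ?_
  tauto

lemma finrank_supportedOn_le {n : ℕ} (U : Finset (Fin n)) :
    Module.finrank (ZMod 2) (supportedOn U) ≤ 2 * U.card := by
  let r : supportedOn U →ₗ[ZMod 2] (U → ZMod 2) × (U → ZMod 2) :=
    { toFun := fun p => (fun i => p.1.1 i, fun i => p.1.2 i)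
      map_add' := fun _ _ => rfl
      map_smul' := fun _ _ => rfl }
  have hr : Function.Injective r := by
    rw [← LinearMap.ker_eq_bot, LinearMap.ker_eq_bot']
    intro p hp
    have h₁ : ∀ i : U, p.1.1 i = 0 := fun i => congrFun (congrArg Prod.fst hp) i
    have h₂ : ∀ i : U, p.1.2 i = 0 := fun i => congrFun (congrArg Prod.snd hp) i
    ext i
    · by_cases hi : i ∈ U
      · exact h₁ ⟨i, hi⟩
      · exact (p.2 i hi).1
    · by_cases hi : i ∈ U
      · exact h₂ ⟨i, hi⟩
      · exact (p.2 i hi).2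
  have h := LinearMap.finrank_le_finrank_of_injective hr
  simpa [Module.finrank_prod, two_mul] using h

/-- `U` supports no nontrivial logical operator of the stabilizer space `M`: every Pauli vector
supported on `U` that commutes with `M` lies in `M`. -/
def NoLogicalOn {n : ℕ} (M : Submodule (ZMod 2) (PauliVec n)) (U : Finset (Fin n)) : Prop :=
  (symp n).orthogonal M ⊓ supportedOn U ≤ M

lemma NoLogicalOn.two_mul_card_le {n : ℕ} {M : Submodule (ZMod 2) (PauliVec n)}
    {U : Finset (Fin n)} (hU : NoLogicalOn M U) :
    2 * U.card + Module.finrank (ZMod 2) ↥(M ⊓ supportedOn Uᶜ) ≤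
      Module.finrank (ZMod 2) M + Module.finrank (ZMod 2) ↥(M ⊓ supportedOn U) := by
  have hle : (symp n).orthogonal (M ⊔ supportedOn Uᶜ) ≤ M ⊓ supportedOn U := by
    intro p hp
    rw [LinearMap.BilinForm.mem_orthogonal_iff] at hp
    have hpU : p ∈ supportedOn U := by
      intro i hi
      have hmem₁ : ((Pi.single i 1, 0) : PauliVec n) ∈ supportedOn Uᶜ := by
        intro j hj
        have : j ≠ i := by rintro rfl; simp_all
        simp [this]
      have hmem₂ : ((0, Pi.single i 1) : PauliVec n) ∈ supportedOn Uᶜ := by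
        intro j hj
        have : j ≠ i := by rintro rfl; simp_all
        simp [this]
      have h₁ := hp _ (Submodule.mem_sup_right hmem₁)
      have h₂ := hp _ (Submodule.mem_sup_right hmem₂)
      rw [symp_single_left] at h₁
      rw [symp_single_right] at h₂
      exact ⟨h₂, h₁⟩
    have hpM : p ∈ (symp n).orthogonal M := by
      rw [LinearMap.BilinForm.mem_orthogonal_iff]
      exact fun q hq => hp q (Submodule.mem_sup_left hq)
    exact ⟨hU ⟨hpM, hpU⟩, hpU⟩
  have h₁ := Submodule.finrank_mono hle
  rw [LinearMap.BilinForm.finrank_orthogonal (symp_nondegenerate n), finrank_pauliVec] at h₁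
  have h₂ := Submodule.finrank_sup_add_finrank_inf_eq M (supportedOn Uᶜ)
  have h₃ := finrank_supportedOn_le Uᶜ
  rw [Finset.card_compl, Fintype.card_fin] at h₃
  have h₄ : U.card ≤ n := by simpa using Finset.card_le_univ U
  omega

/-- The dimension count behind the Bravyi–Poulin–Terhal lemma. -/
lemma card_add_card_le_finrank {n : ℕ} {M : Submodule (ZMod 2) (PauliVec n)}
    {A B : Finset (Fin n)} (hA : NoLogicalOn M A) (hB : NoLogicalOn M B) (hAB : Disjoint A B) :
    A.card + B.card ≤ Module.finrank (ZMod 2) M := by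
  have h₁ := hA.two_mul_card_le
  have h₂ := hB.two_mul_card_le
  have h₃ : Module.finrank (ZMod 2) ↥(M ⊓ supportedOn B) ≤
      Module.finrank (ZMod 2) ↥(M ⊓ supportedOn Aᶜ) :=
    Submodule.finrank_mono (inf_le_inf_left M (supportedOn_mono
      (Finset.subset_compl_iff_disjoint_left.2 hAB)))
  have h₄ : Module.finrank (ZMod 2) ↥(M ⊓ supportedOn A) ≤
      Module.finrank (ZMod 2) ↥(M ⊓ supportedOn Bᶜ) :=
    Submodule.finrank_mono (inf_le_inf_left M (supportedOn_mono
      (Finset.subset_compl_iff_disjoint_right.2 hAB)))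
  omega

/-- The span of the (phase-space vectors of the) generators of a stabilizer code. -/
def StabCode.stabSpace {n m : ℕ} (S : StabCode n m) : Submodule (ZMod 2) (PauliVec n) :=
  Submodule.span (ZMod 2) (Set.range S.gen)

lemma StabCode.mem_orthogonal_stabSpace {n m : ℕ} (S : StabCode n m) {p : PauliVec n} :
    p ∈ (symp n).orthogonal S.stabSpace ↔ ∀ i, symp n (S.gen i) p = 0 := by
  rw [LinearMap.BilinForm.mem_orthogonal_iff]
  refine ⟨fun h i => h _ (Submodule.subset_span ⟨i, rfl⟩), fun h q hq => ?_⟩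
  refine Submodule.span_induction (p := fun q _ => symp n q p = 0) ?_ (by simp) ?_ ?_ hq
  · rintro _ ⟨i, rfl⟩
    exact h i
  · intro x y _ _ hx hy
    simp [hx, hy]
  · intro c x _ hx
    simp [hx]

lemma symp_eq_zero_of_disjoint {n : ℕ} {p q : PauliVec n}
    (h : ∀ i, (p.1 i = 0 ∧ p.2 i = 0) ∨ (q.1 i = 0 ∧ q.2 i = 0)) : symp n p q = 0 := by
  rw [symp_apply]
  refine Finset.sum_eq_zero fun i _ => ?_
  rcases h i with ⟨h₁, h₂⟩ | ⟨h₁, h₂⟩ <;> simp [h₁, h₂]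

/-- Unions of decoupled sets without logical operators carry no logical operators. -/
lemma NoLogicalOn.union {n m : ℕ} {S : StabCode n m} {U W : Finset (Fin n)}
    (hU : NoLogicalOn S.stabSpace U) (hW : NoLogicalOn S.stabSpace W) (hUW : Disjoint U W)
    (hconn : Disconn (connGraph S) U W) : NoLogicalOn S.stabSpace (U ∪ W) := by
  rintro p ⟨hpN, hp⟩
  rw [SetLike.mem_coe, S.mem_orthogonal_stabSpace] at hpN
  let p₁ : PauliVec n := (fun i => if i ∈ U then p.1 i else 0, fun i => if i ∈ U then p.2 i else 0)
  let p₂ : PauliVec n := (fun i => if i ∈ W then p.1 i else 0, fun i => if i ∈ W then p.2 i else 0)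
  have hsum : p = p₁ + p₂ := by
    have key : ∀ i, p.1 i = p₁.1 i + p₂.1 i ∧ p.2 i = p₁.2 i + p₂.2 i := by
      intro i
      by_cases hi : i ∈ U
      · have hi' := Finset.disjoint_left.1 hUW hi
        simp [p₁, p₂, hi, hi']
      · by_cases hi' : i ∈ W
        · simp [p₁, p₂, hi, hi']
        · have := hp i (by simp [hi, hi'])
          simp [p₁, p₂, hi, hi', this]
    ext i
    · exact (key i).1
    · exact (key i).2
  have hp₁ : p₁ ∈ supportedOn U := fun i hi => by simp [p₁, hi]
  have hp₂ : p₂ ∈ supportedOn W := fun i hi => by simp [p₂, hi]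
  have hdec : ∀ j, symp n (S.gen j) p₁ = 0 ∨ symp n (S.gen j) p₂ = 0 := by
    intro j
    by_contra! hne
    have h₁ : ∃ u ∈ U, u ∈ pauliSupp (S.gen j).1 (S.gen j).2 := by
      by_contra! hcon
      refine hne.1 (symp_eq_zero_of_disjoint fun i => ?_)
      by_cases hi : i ∈ U
      · have := hcon i hi
        simp only [pauliSupp, Finset.mem_filter, Finset.mem_univ, true_and] at this
        tauto
      · exact Or.inr (hp₁ i hi)
    have h₂ : ∃ w ∈ W, w ∈ pauliSupp (S.gen j).1 (S.gen j).2 := by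
      by_contra! hcon
      refine hne.2 (symp_eq_zero_of_disjoint fun i => ?_)
      by_cases hi : i ∈ W
      · have := hcon i hi
        simp only [pauliSupp, Finset.mem_filter, Finset.mem_univ, true_and] at this
        tauto
      · exact Or.inr (hp₂ i hi)
    obtain ⟨u, huU, hu⟩ := h₁
    obtain ⟨w, hwW, hw⟩ := h₂
    refine hconn u huU w hwW ?_
    rw [connGraph, SimpleGraph.fromRel_adj]
    exact ⟨fun h => Finset.disjoint_left.1 hUW huU (h ▸ hwW), Or.inl ⟨j, hu, hw⟩⟩
  have hboth : ∀ j, symp n (S.gen j) p₁ = 0 ∧ symp n (S.gen j) p₂ = 0 := by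
    intro j
    have h := hpN j
    rw [hsum, map_add] at h
    rcases hdec j with h' | h' <;> rw [h'] at h <;> simp_all
  rw [hsum]
  exact add_mem (hU ⟨S.mem_orthogonal_stabSpace.2 fun j => (hboth j).1, hp₁⟩)
    (hW ⟨S.mem_orthogonal_stabSpace.2 fun j => (hboth j).2, hp₂⟩)

/-- The sign character of `ZMod 2`. -/
noncomputable def chi (x : ZMod 2) : ℂ := (-1) ^ x.val

lemma chi_zero : chi 0 = 1 := by simp [chi]

lemma chi_one : chi 1 = -1 := by simp [chi, ZMod.val_one]

lemma chi_add (x y : ZMod 2) : chi (x + y) = chi x * chi y := by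
  rw [chi, chi, chi, ← pow_add, ZMod.val_add, ← neg_one_pow_eq_pow_mod_two]

lemma chi_mul_self (x : ZMod 2) : chi x * chi x = 1 := by
  rw [← chi_add, CharTwo.add_self_eq_zero, chi_zero]

lemma norm_chi (x : ZMod 2) : ‖chi x‖ = 1 := by simp [chi]

lemma chi_ne_zero (x : ZMod 2) : chi x ≠ 0 := by simp [chi]

lemma neg_one_pow_sum_val {n : ℕ} (b g : QIdx n) :
    (-1 : ℂ) ^ (∑ i, (b i * g i).val) = chi (∑ i, b i * g i) := by
  rw [← Finset.prod_pow_eq_pow_sum]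
  induction (Finset.univ : Finset (Fin n)) using Finset.induction_on with
  | empty => simp [chi_zero]
  | insert i s hi ih => rw [Finset.prod_insert hi, Finset.sum_insert hi, chi_add, ih]; rfl

/-- The Pauli operator of a phase-space vector. -/
noncomputable def pauliOf {n : ℕ} (p : PauliVec n) : Matrix (QIdx n) (QIdx n) ℂ :=
  pauliXZ p.1 p.2

lemma pauliOf_apply {n : ℕ} (p : PauliVec n) (f g : QIdx n) :
    pauliOf p f g = if f = g + p.1 then chi (∑ i, p.2 i * g i) else 0 := by
  rw [pauliOf, pauliXZ, neg_one_pow_sum_val]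

lemma pauliOf_zero {n : ℕ} : pauliOf (0 : PauliVec n) = 1 := by
  ext f g
  simp [pauliOf_apply, Matrix.one_apply, chi_zero]

lemma pauliOf_mul {n : ℕ} (p q : PauliVec n) :
    pauliOf p * pauliOf q = chi (∑ i, p.2 i * q.1 i) • pauliOf (p + q) := by
  ext f g
  simp only [Matrix.mul_apply, Matrix.smul_apply, pauliOf_apply, smul_eq_mul]
  rw [Finset.sum_eq_single (g + q.1)]
  · rw [if_pos rfl]
    simp only [Prod.fst_add, Prod.snd_add, add_assoc, add_comm q.1 p.1]
    split_ifs
    · simp only [Pi.add_apply, mul_add, add_mul, Finset.sum_add_distrib, chi_add]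
      ring
    · simp
  · intro h _ hh
    rw [if_neg hh, mul_zero]
  · simp

lemma pauliOf_mul_comm {n : ℕ} (p q : PauliVec n) :
    pauliOf p * pauliOf q = chi (symp n p q) • (pauliOf q * pauliOf p) := by
  rw [pauliOf_mul, pauliOf_mul, smul_smul, add_comm q p]
  congr 1
  rw [← chi_add]
  congr 1
  rw [symp_apply, ← Finset.sum_add_distrib]
  refine Finset.sum_congr rfl fun i _ => ?_
  linear_combination (-(q.2 i * p.1 i)) * (CharTwo.two_eq_zero : (2 : ZMod 2) = 0)

lemma pauliOf_mul_self {n : ℕ} (p : PauliVec n) :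
    pauliOf p * pauliOf p = chi (∑ i, p.2 i * p.1 i) • 1 := by
  have h : p + p = 0 := by
    ext i <;> simp [CharTwo.add_self_eq_zero]
  rw [pauliOf_mul, h, pauliOf_zero]

lemma pauliOf_mul_eq_zero {n : ℕ} {p : PauliVec n} {M : Matrix (QIdx n) (QIdx n) ℂ}
    (h : pauliOf p * M = 0) : M = 0 := by
  have h' : pauliOf p * (pauliOf p * M) = 0 := by rw [h, mul_zero]
  rw [← mul_assoc, pauliOf_mul_self, smul_mul_assoc, one_mul] at h'
  exact (smul_eq_zero.1 h').resolve_left (chi_ne_zero _)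

lemma zmod_two_eq_one_of_ne_zero {x : ZMod 2} (h : x ≠ 0) : x = 1 := by
  revert h; revert x; decide

lemma trace_pauliOf_of_ne_zero {n : ℕ} {p : PauliVec n} (hp : p ≠ 0) :
    (pauliOf p).trace = 0 := by
  obtain ⟨q, hq⟩ : ∃ q, symp n q p ≠ 0 := by
    by_contra! h
    exact hp (eq_zero_of_symp_eq_zero h)
  have h₁ : pauliOf q * pauliOf p = -(pauliOf p * pauliOf q) := by
    rw [pauliOf_mul_comm, zmod_two_eq_one_of_ne_zero hq, chi_one, neg_smul, one_smul]
  have h₂ : (pauliOf q * pauliOf p * pauliOf q).trace =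
      (pauliOf p * pauliOf q * pauliOf q).trace := by
    rw [mul_assoc, Matrix.trace_mul_comm]
  rw [h₁, neg_mul, Matrix.trace_neg, mul_assoc, pauliOf_mul_self, mul_smul_comm, mul_one,
    Matrix.trace_smul, smul_eq_mul] at h₂
  have h₃ := chi_ne_zero (∑ i, q.2 i * q.1 i)
  exact (mul_eq_zero.1 (neg_eq_self.1 h₂)).resolve_left h₃

lemma norm_trace_pauliOf {n : ℕ} (p : PauliVec n) :
    ‖(pauliOf p).trace‖ = if p = 0 then (2 : ℝ) ^ n else 0 := by
  split_ifs with h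
  · simp [h, pauliOf_zero, Matrix.trace_one, ZMod.card]
  · rw [trace_pauliOf_of_ne_zero h, norm_zero]

/-- Expansion of the product `∏ (I ± S_i)` into Pauli operators with unimodular coefficients. -/
lemma exists_prod_expansion {n : ℕ} :
    ∀ (m : ℕ) (e : Fin m → PauliVec n) (s : Fin m → ℂ), (∀ i, ‖s i‖ = 1) →
      ∃ c : (Fin m → ZMod 2) → ℂ, (∀ v, ‖c v‖ = 1) ∧
        (List.ofFn fun i => (1 : Matrix (QIdx n) (QIdx n) ℂ) + s i • pauliOf (e i)).prod =
          ∑ v, c v • pauliOf (∑ i, v i • e i) := by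
  intro m
  induction m with
  | zero =>
    intro e s _
    exact ⟨fun _ => 1, by simp, by simp [pauliOf_zero]⟩
  | succ m ih =>
    intro e s hs
    obtain ⟨c, hc, hprod⟩ := ih (fun i => e i.succ) (fun i => s i.succ) fun i => hs _
    let t : (Fin m → ZMod 2) → PauliVec n := fun v => ∑ i, v i • e i.succ
    refine ⟨fun v => if v 0 = 0 then c (fun i => v i.succ) else
      s 0 * c (fun i => v i.succ) * chi (∑ i, (e 0).2 i * (t fun i => v i.succ).1 i), ?_, ?_⟩
    · intro v
      dsimp only
      split_ifs
      · exact hc _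
      · simp [hs, hc, norm_chi]
    · rw [List.ofFn_succ, List.prod_cons, hprod,
        ← (Fin.consEquiv fun _ : Fin (m + 1) => ZMod 2).sum_comp, Fintype.sum_prod_type]
      have h2 : (Finset.univ : Finset (ZMod 2)) = {0, 1} := by decide
      rw [h2, Finset.sum_pair (by decide), add_mul, one_mul]
      congr 1
      · refine Finset.sum_congr rfl fun v _ => ?_
        simp [Fin.consEquiv, Fin.sum_univ_succ]
      · rw [smul_mul_assoc, Finset.mul_sum, Finset.smul_sum]
        refine Finset.sum_congr rfl fun v _ => ?_
        rw [mul_smul_comm, pauliOf_mul, smul_smul, smul_smul]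
        simp [Fin.consEquiv, Fin.sum_univ_succ, t]

lemma StabCode.norm_sign {n m : ℕ} (S : StabCode n m) (i : Fin m) : ‖S.sign i‖ = 1 := by
  rcases S.sign_pm i with h | h <;> simp [h]

/-- The number of logical qubits is at most `n` minus the rank of the stabilizer. -/
lemma HasDim.add_finrank_le {n m k : ℕ} {S : StabCode n m} (h : HasDim S k) :
    k + Module.finrank (ZMod 2) S.stabSpace ≤ n := by
  obtain ⟨c, hc, hprod⟩ := exists_prod_expansion m S.gen S.sign S.norm_sign
  let L := Fintype.linearCombination (ZMod 2) S.gen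
  have hcard : (Finset.univ.filter fun v : Fin m → ZMod 2 => ∑ i, v i • S.gen i = 0).card =
      2 ^ Module.finrank (ZMod 2) (LinearMap.ker L) := by
    have h₁ := Module.card_eq_pow_finrank (K := ZMod 2) (V := LinearMap.ker L)
    rw [ZMod.card] at h₁
    rw [← h₁, Fintype.card_subtype]
    simp [L, Fintype.linearCombination_apply]
  have hrank : Module.finrank (ZMod 2) S.stabSpace + Module.finrank (ZMod 2) (LinearMap.ker L) =
      m := by
    have h₁ := L.finrank_range_add_finrank_ker
    rw [Fintype.range_linearCombination, Module.finrank_fintype_fun_eq_card, Fintype.card_fin] at h₁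
    exact h₁
  have htr : (2 : ℝ) ^ k ≤ ((2 : ℝ) ^ m)⁻¹ *
      ((2 : ℝ) ^ Module.finrank (ZMod 2) (LinearMap.ker L) * 2 ^ n) := by
    have h₁ : ‖S.proj.trace‖ = (2 : ℝ) ^ k := by rw [show S.proj.trace = _ from h]; simp
    rw [← h₁, StabCode.proj, Matrix.trace_smul, norm_smul, norm_inv, norm_pow,
      RCLike.norm_ofNat]
    refine mul_le_mul_of_nonneg_left ?_ (by positivity)
    change ‖(List.ofFn fun i => (1 : Matrix (QIdx n) (QIdx n) ℂ) +
      S.sign i • pauliOf (S.gen i)).prod.trace‖ ≤ _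
    rw [hprod, Matrix.trace_sum]
    refine (norm_sum_le _ _).trans (le_of_eq ?_)
    simp only [Matrix.trace_smul, norm_smul, hc, one_mul, norm_trace_pauliOf]
    rw [← Finset.sum_filter, Finset.sum_const, hcard, nsmul_eq_mul]
    norm_num
  have hpow : (2 : ℝ) ^ (m + k) ≤ 2 ^ (Module.finrank (ZMod 2) (LinearMap.ker L) + n) := by
    rw [inv_mul_eq_div, le_div_iff₀ (by positivity)] at htr
    rw [pow_add, pow_add]
    linarith
  have := (pow_le_pow_iff_right₀ (by norm_num : (1 : ℝ) < 2)).1 hpow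
  omega

lemma StabCode.commute_proj {n m : ℕ} (S : StabCode n m) {p : PauliVec n}
    (hp : p ∈ (symp n).orthogonal S.stabSpace) : Commute (pauliOf p) S.proj := by
  rw [StabCode.proj]
  refine Commute.smul_right (Commute.list_prod_right _ _ fun x hx => ?_) _
  obtain ⟨i, rfl⟩ := (List.mem_ofFn' _ _).1 hx
  refine (Commute.one_right _).add_right (Commute.smul_right ?_ _)
  change pauliOf p * pauliOf (S.gen i) = pauliOf (S.gen i) * pauliOf p
  rw [pauliOf_mul_comm, symp_comm, S.mem_orthogonal_stabSpace.1 hp i, chi_zero, one_smul]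

/-- Sets smaller than the distance carry no logical operators. -/
lemma HasDistanceGe.noLogicalOn {n m k d : ℕ} {S : StabCode n m} (hk : HasDim S k)
    (hd : HasDistanceGe S d) {U : Finset (Fin n)} (hU : U.card < d) :
    NoLogicalOn S.stabSpace U := by
  rintro p ⟨hpN, hpU⟩
  have htr : S.proj.trace ≠ 0 := by
    rw [show S.proj.trace = _ from hk]
    positivity
  have hP : S.proj ≠ 0 := fun h => htr (by rw [h, Matrix.trace_zero])
  obtain ⟨z₀, hz₀⟩ : ∃ z : ℂ, S.proj * S.proj = z • S.proj := by
    obtain ⟨z, hz⟩ := hd 0 0 (by simpa [pauliSupp] using (Nat.zero_le _).trans_lt hU)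
    refine ⟨z, ?_⟩
    rwa [show pauliXZ (0 : QIdx n) 0 = 1 from pauliOf_zero, mul_one] at hz
  have hz₀_ne : z₀ ≠ 0 := by
    rintro rfl
    have hnil : IsNilpotent S.proj := ⟨2, by rw [pow_two, hz₀, zero_smul]⟩
    exact htr (Matrix.isNilpotent_trace_of_isNilpotent hnil).eq_zero
  obtain ⟨z, hz⟩ : ∃ z : ℂ, S.proj * pauliOf p * S.proj = z • S.proj :=
    hd p.1 p.2 ((Finset.card_le_card (mem_supportedOn_iff_pauliSupp.1 hpU)).trans_lt hU)
  by_contra hpM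
  obtain ⟨q, hqN, hq⟩ : ∃ q ∈ (symp n).orthogonal S.stabSpace, symp n q p ≠ 0 := by
    by_contra! hcon
    apply hpM
    rw [← LinearMap.BilinForm.orthogonal_orthogonal (symp_nondegenerate n) (symp_isRefl n)
      S.stabSpace, LinearMap.BilinForm.mem_orthogonal_iff]
    exact hcon
  have hcp := S.commute_proj hpN
  have hcq := S.commute_proj hqN
  have hanti : pauliOf q * pauliOf p = -(pauliOf p * pauliOf q) := by
    rw [pauliOf_mul_comm, zmod_two_eq_one_of_ne_zero hq, chi_one, neg_smul, one_smul]
  have hz' : z₀ • (pauliOf p * S.proj) = z • S.proj := by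
    rw [← hz, ← hcp.eq, mul_assoc, hz₀, mul_smul_comm]
  have h₁ : z • (pauliOf q * S.proj) = -(z • (pauliOf q * S.proj)) := by
    calc z • (pauliOf q * S.proj) = pauliOf q * (z₀ • (pauliOf p * S.proj)) := by
          rw [hz', mul_smul_comm]
      _ = -(z₀ • (pauliOf p * S.proj) * pauliOf q) := by
          rw [mul_smul_comm, ← mul_assoc, hanti, neg_mul, mul_assoc, hcq.eq, ← mul_assoc,
            smul_mul_assoc, smul_neg]
      _ = -(z • (pauliOf q * S.proj)) := by rw [hz', smul_mul_assoc, hcq.eq]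
  have hz0 : z = 0 := by
    have h₂ : (2 * z) • (pauliOf q * S.proj) = 0 := by
      rw [two_mul, add_smul]
      nth_rewrite 1 [h₁]
      exact neg_add_cancel _
    have h₃ := (smul_eq_zero.1 h₂).resolve_right fun h => hP (pauliOf_mul_eq_zero h)
    simpa using h₃
  rw [hz0, zero_smul] at hz'
  exact hP (pauliOf_mul_eq_zero ((smul_eq_zero.1 hz').resolve_left hz₀_ne))

/-- The total relative weight of separators removed above scale `r` when `G` is recursively
separated down to pieces of size less than `d`. -/
noncomputable def sepPotential (K L c : ℝ) (d : ℕ) (t : ℝ) : ℝ :=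
  K * (d : ℝ) ^ (c - 1) - L * t ^ (c - 1)

/-- Recursive separation: if `good` sets include all sets of size less than `d` and are closed
under unions of decoupled pairs, then `H` becomes good after removing `O(|H| d^(c-1))` vertices. -/
lemma exists_good_sdiff {V : Type*} [DecidableEq V] {G : SimpleGraph V} {β c L : ℝ}
    (hG : HasSepProfile G β c) (hc1 : c < 1) (hL : 0 ≤ L)
    (hLβ : L * (2 / 3 : ℝ) ^ (c - 1) = L + β) {d : ℕ} (hd : 0 < d) {good : Finset V → Prop}
    (hsmall : ∀ U, U.card < d → good U)
    (hunion : ∀ U W, good U → good W → Disjoint U W → Disconn G U W → good (U ∪ W))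
    (H : Finset V) :
    ∃ X ⊆ H, good (H \ X) ∧ (X.card : ℝ) ≤ H.card * ((L + β) * (d : ℝ) ^ (c - 1)) := by
  have hd' : (0 : ℝ) < d := by exact_mod_cast hd
  suffices hmain : ∀ (s : ℕ) (H : Finset V), H.card = s → ∀ t : ℝ, (s : ℝ) ≤ t →
      2 / 3 * (d : ℝ) ≤ t → ∃ X ⊆ H, good (H \ X) ∧
        (X.card : ℝ) ≤ s * sepPotential (L + β) L c d t by
    obtain ⟨X, hX, hgood, hcard⟩ := hmain H.card H rfl (H.card + d) (by linarith) (by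
      have : (0 : ℝ) ≤ H.card := by positivity
      linarith)
    refine ⟨X, hX, hgood, hcard.trans ?_⟩
    refine mul_le_mul_of_nonneg_left ?_ (by positivity)
    have : 0 ≤ L * ((H.card : ℝ) + d) ^ (c - 1) := by positivity
    rw [sepPotential]
    linarith
  intro s
  induction s using Nat.strong_induction_on with
  | _ s ih =>
    intro H hH t hst hdt
    have ht : 0 < t := by linarith
    rcases lt_or_ge s d with hsd | hsd
    · refine ⟨∅, Finset.empty_subset _, by simpa using hsmall H (hH ▸ hsd), ?_⟩
      have h₁ : t ^ (c - 1) ≤ (2 / 3 * (d : ℝ)) ^ (c - 1) :=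
        Real.rpow_le_rpow_of_nonpos (by positivity) hdt (by linarith)
      rw [Real.mul_rpow (by norm_num) hd'.le] at h₁
      have h₂ := mul_le_mul_of_nonneg_left h₁ hL
      rw [← mul_assoc, hLβ] at h₂
      have h₃ : 0 ≤ sepPotential (L + β) L c d t := by rw [sepPotential]; linarith
      simpa using mul_nonneg (Nat.cast_nonneg s) h₃
    · have hs0 : 0 < s := hd.trans_le hsd
      have hs : (0 : ℝ) < s := by exact_mod_cast hs0
      have hsd' : (d : ℝ) ≤ s := by exact_mod_cast hsd
      obtain ⟨T, U₁, U₂, hTU, hT₁, hT₂, hU, hdis, hb₁, hb₂, hT⟩ := hG H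
      rw [hH] at hb₁ hb₂ hT
      have hb₁' : (U₁.card : ℝ) ≤ 2 / 3 * s := by
        have : (3 : ℝ) * U₁.card ≤ 2 * s := by exact_mod_cast hb₁
        linarith
      have hb₂' : (U₂.card : ℝ) ≤ 2 / 3 * s := by
        have : (3 : ℝ) * U₂.card ≤ 2 * s := by exact_mod_cast hb₂
        linarith
      obtain ⟨X₁, hX₁, hg₁, hc₁⟩ := ih U₁.card (by omega) U₁ rfl (2 / 3 * s) hb₁' (by linarith)
      obtain ⟨X₂, hX₂, hg₂, hc₂⟩ := ih U₂.card (by omega) U₂ rfl (2 / 3 * s) hb₂' (by linarith)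
      have hsub : T ∪ X₁ ∪ X₂ ⊆ H := by
        rw [← hTU]
        exact Finset.union_subset_union (Finset.union_subset_union_right hX₁) hX₂
      refine ⟨T ∪ X₁ ∪ X₂, hsub, ?_, ?_⟩
      · have heq : H \ (T ∪ X₁ ∪ X₂) = (U₁ \ X₁) ∪ (U₂ \ X₂) := by
          rw [← hTU]
          ext v
          have h₁ : v ∈ T → v ∉ U₁ := fun h => Finset.disjoint_left.1 hT₁ h
          have h₂ : v ∈ T → v ∉ U₂ := fun h => Finset.disjoint_left.1 hT₂ h
          have h₃ : v ∈ U₁ → v ∉ U₂ := fun h => Finset.disjoint_left.1 hU h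
          have h₄ : v ∈ X₁ → v ∈ U₁ := fun h => hX₁ h
          have h₅ : v ∈ X₂ → v ∈ U₂ := fun h => hX₂ h
          simp only [Finset.mem_sdiff, Finset.mem_union]
          tauto
        rw [heq]
        refine hunion _ _ hg₁ hg₂ (hU.mono Finset.sdiff_subset Finset.sdiff_subset) ?_
        exact fun a ha b hb => hdis a (Finset.sdiff_subset ha) b (Finset.sdiff_subset hb)
      · have hpot : sepPotential (L + β) L c d (2 / 3 * s) =
            (L + β) * (d : ℝ) ^ (c - 1) - (L + β) * (s : ℝ) ^ (c - 1) := by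
          rw [sepPotential, Real.mul_rpow (by norm_num) hs.le, ← mul_assoc, hLβ]
        have hLβ0 : 0 ≤ L + β := by
          rw [← hLβ]
          positivity
        have hpot0 : 0 ≤ sepPotential (L + β) L c d (2 / 3 * s) := by
          rw [hpot]
          have := mul_le_mul_of_nonneg_left
            (Real.rpow_le_rpow_of_nonpos hd' hsd' (by linarith : c - 1 ≤ 0)) hLβ0
          linarith
        have hcard : ((T ∪ X₁ ∪ X₂).card : ℝ) ≤ T.card + X₁.card + X₂.card := by
          have h₁ := Finset.card_union_le (T ∪ X₁) X₂
          have h₂ := Finset.card_union_le T X₁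
          exact_mod_cast h₁.trans (by omega)
        have hUs : (U₁.card : ℝ) + U₂.card ≤ s := by
          have h₁ : (U₁ ∪ U₂).card ≤ H.card :=
            Finset.card_le_card (by rw [← hTU, Finset.union_assoc]; exact Finset.subset_union_right)
          rw [Finset.card_union_of_disjoint hU, hH] at h₁
          exact_mod_cast h₁
        have hUpot := mul_le_mul_of_nonneg_right hUs hpot0
        have hsc : (s : ℝ) ^ c = s * (s : ℝ) ^ (c - 1) := by
          rw [Real.rpow_sub_one hs.ne']
          field_simp
        rw [hsc] at hT
        have hmono : t ^ (c - 1) ≤ (s : ℝ) ^ (c - 1) :=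
          Real.rpow_le_rpow_of_nonpos hs hst (by linarith)
        have hfin : (s : ℝ) * (L * t ^ (c - 1)) ≤ s * (L * (s : ℝ) ^ (c - 1)) :=
          mul_le_mul_of_nonneg_left (mul_le_mul_of_nonneg_left hmono hL) hs.le
        rw [sepPotential]
        rw [hpot] at hUpot hc₁ hc₂
        linarith

/-- Theorem 23 of Baspin–Krishna: for `β ≥ 1`, `c ∈ (0,1)` there is
`α = α(β,c)` such that any `⟦n,k,d⟧` stabilizer code whose connectivity graph satisfies
`s_G(r) ≤ β r^c` for all `r` obeys `k·d^{2(1−c)} ≤ α·n`. -/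
theorem kd_tradeoff_weak (β c : ℝ) (hβ : 1 ≤ β) (hc0 : 0 < c) (hc1 : c < 1) :
    ∃ α : ℝ, 0 < α ∧
      ∀ (n m k d : ℕ) (S : StabCode n m),
        HasDim S k → HasDistanceGe S d → HasSepProfile (connGraph S) β c →
        (k : ℝ) * (d : ℝ) ^ (2 * (1 - c)) ≤ α * n := by
  have hq : 1 < (2 / 3 : ℝ) ^ (c - 1) :=
    Real.one_lt_rpow_of_pos_of_lt_one_of_neg (by norm_num) (by norm_num) (by linarith)
  set q : ℝ := (2 / 3 : ℝ) ^ (c - 1) with hq_def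
  set L : ℝ := β / (q - 1) with hL_def
  have hL : 0 ≤ L := div_nonneg (by linarith) (by linarith)
  have hLβ : L * q = L + β := by
    have : L * (q - 1) = β := div_mul_cancel₀ _ (by linarith)
    linarith
  have hK : 0 < L + β := by linarith
  refine ⟨(L + β) ^ 2, by positivity, fun n m k d S hdim hdist hsep => ?_⟩
  rcases Nat.eq_zero_or_pos d with rfl | hd
  · rw [Nat.cast_zero, Real.zero_rpow (by linarith), mul_zero]
    positivity
  have hd' : (0 : ℝ) < d := by exact_mod_cast hd
  have hpart := exists_good_sdiff hsep hc1 hL hLβ hd (good := NoLogicalOn S.stabSpace)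
    (fun U hU => hdist.noLogicalOn hdim hU) (fun U W hU hW hUW h => hU.union hW hUW h)
  obtain ⟨X, -, hgX, hX⟩ := hpart Finset.univ
  obtain ⟨Y, hYX, hgY, hY⟩ := hpart X
  have hrank := card_add_card_le_finrank hgX hgY
    (Finset.disjoint_left.2 fun v hv hv' => by simp_all)
  have hkn := hdim.add_finrank_le
  have hkY : k ≤ Y.card := by
    have h₁ := Finset.card_sdiff_add_card_eq_card (Finset.subset_univ X)
    have h₂ := Finset.card_sdiff_add_card_eq_card hYX
    rw [Finset.card_univ, Fintype.card_fin] at h₁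
    omega
  rw [Finset.card_univ, Fintype.card_fin] at hX
  have hkY' : (k : ℝ) ≤ Y.card := by exact_mod_cast hkY
  set D : ℝ := (d : ℝ) ^ (c - 1) with hD_def
  have hD : 0 < D := by positivity
  have hk : (k : ℝ) ≤ n * ((L + β) * D) * ((L + β) * D) :=
    hkY'.trans (hY.trans (mul_le_mul_of_nonneg_right hX (by positivity)))
  have hDD : D * D * (d : ℝ) ^ (2 * (1 - c)) = 1 := by
    rw [hD_def, ← Real.rpow_add hd', ← Real.rpow_add hd', ← Real.rpow_zero (d : ℝ)]
    congr 1
    ring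
  calc (k : ℝ) * (d : ℝ) ^ (2 * (1 - c))
      ≤ n * ((L + β) * D) * ((L + β) * D) * (d : ℝ) ^ (2 * (1 - c)) :=
        mul_le_mul_of_nonneg_right hk (by positivity)
    _ = (L + β) ^ 2 * n * (D * D * (d : ℝ) ^ (2 * (1 - c))) := by ring
    _ = (L + β) ^ 2 * n := by rw [hDD, mul_one]
end

section
/- (Degree-oblivious distance bound) Let β ≥ 1 and c ∈ (0,1). There exists α = α(β,c) > 0 such that any ⟦n,k,d⟧ stabilizer code with k ≥ 1 whose connectivity graph has separation profile s_G(r) ≤ β·r^c for all r satisfies d ≤ α·n^c. -/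
open scoped Classical ComplexOrder
open Finset

/-- The nontrivial additive character of `ZMod 2`. -/
noncomputable def zmodTwoSign (x : ZMod 2) : ℂ := (-1) ^ x.val

@[simp] lemma zmodTwoSign_zero : zmodTwoSign 0 = 1 := by simp [zmodTwoSign]

lemma zmodTwoSign_one : zmodTwoSign 1 = -1 := by
  have : (1 : ZMod 2).val = 1 := rfl
  simp [zmodTwoSign, this]

lemma zmodTwoSign_add (x y : ZMod 2) :
    zmodTwoSign (x + y) = zmodTwoSign x * zmodTwoSign y := by
  have h : (1 : ZMod 2) + 1 = 0 := rfl
  have key : ∀ z : ZMod 2, z = 0 ∨ z = 1 := by decide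
  rcases key x with rfl | rfl <;> rcases key y with rfl | rfl <;> simp [zmodTwoSign_one, h]

lemma norm_zmodTwoSign (x : ZMod 2) : ‖zmodTwoSign x‖ = 1 := by
  simp [zmodTwoSign]

lemma zmodTwoSign_ne_zero (x : ZMod 2) : zmodTwoSign x ≠ 0 := by
  simp [zmodTwoSign]

lemma zmodTwoSign_sum {ι : Type*} (s : Finset ι) (f : ι → ZMod 2) :
    zmodTwoSign (∑ i ∈ s, f i) = ∏ i ∈ s, zmodTwoSign (f i) := by
  induction s using Finset.cons_induction with
  | empty => simp
  | cons a s ha ih => rw [sum_cons, prod_cons, zmodTwoSign_add, ih]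

lemma pauliXZ_apply {n : ℕ} (a b f g : QIdx n) :
    pauliXZ a b f g = if f = g + a then zmodTwoSign (b ⬝ᵥ g) else 0 := by
  rw [pauliXZ, dotProduct, zmodTwoSign_sum, ← Finset.prod_pow_eq_pow_sum]
  rfl

lemma pauliXZ_mul {n : ℕ} (a b a' b' : QIdx n) :
    pauliXZ a b * pauliXZ a' b' =
      zmodTwoSign (b ⬝ᵥ a') • pauliXZ (a + a') (b + b') := by
  ext f g
  simp only [Matrix.mul_apply, pauliXZ_apply, Matrix.smul_apply, smul_eq_mul, mul_ite, mul_zero]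
  rw [Finset.sum_ite_eq' univ (g + a')]
  have : g + a' + a = g + (a + a') := by abel
  simp only [mem_univ, if_true, this, ite_mul, zero_mul]
  split_ifs
  · rw [dotProduct_add, add_dotProduct, zmodTwoSign_add, zmodTwoSign_add]
    ring
  · rfl

lemma pauliXZ_zero {n : ℕ} : pauliXZ (0 : QIdx n) 0 = 1 := by
  ext f g
  simp [pauliXZ_apply, Matrix.one_apply]

lemma pauliXZ_mul_self {n : ℕ} (a b : QIdx n) :
    pauliXZ a b * pauliXZ a b = zmodTwoSign (b ⬝ᵥ a) • (1 : Matrix (QIdx n) (QIdx n) ℂ) := by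
  have h : ∀ x : QIdx n, x + x = 0 := fun x => funext fun i => CharTwo.add_self_eq_zero (x i)
  rw [pauliXZ_mul, h, h, pauliXZ_zero]

lemma trace_pauliXZ {n : ℕ} (a b : QIdx n) :
    (pauliXZ a b).trace = if a = 0 ∧ b = 0 then (2 : ℂ) ^ n else 0 := by
  split_ifs with h
  · obtain ⟨rfl, rfl⟩ := h
    simp [pauliXZ_zero, Matrix.trace_one]
  · by_cases ha : a = 0
    · subst ha
      have hb : b ≠ 0 := fun hb => h ⟨rfl, hb⟩
      obtain ⟨i, hi⟩ := Function.ne_iff.mp hb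
      have hi1 : b i = 1 := Fin.eq_one_of_ne_zero _ hi
      simp only [Matrix.trace, Matrix.diag, pauliXZ_apply, add_zero, if_true]
      have key : ∑ g : QIdx n, zmodTwoSign (b ⬝ᵥ g) = -∑ g : QIdx n, zmodTwoSign (b ⬝ᵥ g) := by
        conv_lhs => rw [← Equiv.sum_comp (Equiv.addRight (Pi.single i (1 : ZMod 2)))]
        simp [dotProduct_add, zmodTwoSign_add, hi1, zmodTwoSign_one]
      exact self_eq_neg.mp key
    · refine Finset.sum_eq_zero fun g _ => ?_
      simp [pauliXZ_apply, ha]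

/-- The symplectic form on binary vectors labelling Pauli operators. -/
def symplForm (n : ℕ) : LinearMap.BilinForm (ZMod 2) (QIdx n × QIdx n) :=
  LinearMap.mk₂ (ZMod 2) (fun v w => v.1 ⬝ᵥ w.2 + w.1 ⬝ᵥ v.2)
    (fun u v w => by simp only [Prod.fst_add, Prod.snd_add, add_dotProduct, dotProduct_add]; ring)
    (fun r v w => by simp [mul_add])
    (fun u v w => by simp only [Prod.fst_add, Prod.snd_add, add_dotProduct, dotProduct_add]; ring)
    (fun r v w => by simp [mul_add])

lemma symplForm_apply {n : ℕ} (v w : QIdx n × QIdx n) :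
    symplForm n v w = ∑ i, (v.1 i * w.2 i + w.1 i * v.2 i) := by
  simp [symplForm, dotProduct, Finset.sum_add_distrib]

lemma symplForm_comm {n : ℕ} (v w : QIdx n × QIdx n) : symplForm n v w = symplForm n w v := by
  simp only [symplForm_apply, add_comm]

lemma symplForm_isRefl (n : ℕ) : (symplForm n).IsRefl := fun v w h => by
  rwa [symplForm_comm]

lemma symplForm_single_left {n : ℕ} (i : Fin n) (w : QIdx n × QIdx n) :
    symplForm n (Pi.single i 1, 0) w = w.2 i := by
  simp [symplForm]

lemma symplForm_single_right {n : ℕ} (i : Fin n) (w : QIdx n × QIdx n) :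
    symplForm n (0, Pi.single i 1) w = w.1 i := by
  simp [symplForm]

lemma symplForm_nondegenerate (n : ℕ) : (symplForm n).Nondegenerate := by
  refine (symplForm_isRefl n).nondegenerate_iff_separatingRight.mpr ?_
  intro w hw
  ext i
  · simpa [symplForm_single_right] using hw (0, Pi.single i 1)
  · simpa [symplForm_single_left] using hw (Pi.single i 1, 0)

lemma pauliXZ_commute {n : ℕ} {v w : QIdx n × QIdx n} (h : symplForm n v w = 0) :
    Commute (pauliXZ v.1 v.2) (pauliXZ w.1 w.2) := by
  have h' : v.2 ⬝ᵥ w.1 = w.2 ⬝ᵥ v.1 := by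
    rw [dotProduct_comm v.2, dotProduct_comm w.2]
    refine (CharTwo.add_eq_zero.mp ?_).symm
    simpa [symplForm] using h
  rw [Commute, SemiconjBy, pauliXZ_mul, pauliXZ_mul, h', add_comm v.1, add_comm v.2]

/-- Expansion of a product `∏ (1 + sᵢ Pᵢ)` of Pauli operators over all subproducts. -/
lemma exists_prod_one_add_pauliXZ {n : ℕ} : ∀ {m : ℕ} (gen : Fin m → QIdx n × QIdx n)
    (sign : Fin m → ℂ), (∀ i, ‖sign i‖ = 1) →
    ∃ φ : (Fin m → ZMod 2) → ℂ, (∀ x, ‖φ x‖ = 1) ∧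
      (List.ofFn fun i => (1 : Matrix (QIdx n) (QIdx n) ℂ) +
        sign i • pauliXZ (gen i).1 (gen i).2).prod =
      ∑ x, φ x • pauliXZ (Fintype.linearCombination (ZMod 2) gen x).1
        (Fintype.linearCombination (ZMod 2) gen x).2
  | 0, gen, sign, _ => ⟨fun _ => 1, by simp, by
      simp [Fintype.linearCombination_apply, pauliXZ_zero]⟩
  | m + 1, gen, sign, hs => by
    obtain ⟨φ, hφ, h⟩ := exists_prod_one_add_pauliXZ (fun i => gen i.succ)
      (fun i => sign i.succ) fun i => hs _
    refine ⟨fun x => φ (Fin.tail x) * if x 0 = 0 then 1 else sign 0 *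
      zmodTwoSign ((gen 0).2 ⬝ᵥ
        (Fintype.linearCombination (ZMod 2) (fun i => gen i.succ) (Fin.tail x)).1), ?_, ?_⟩
    · intro x
      dsimp only
      split_ifs <;> simp [hφ, hs, norm_zmodTwoSign]
    · have htail : ∀ (a : ZMod 2) (x : Fin m → ZMod 2),
          Fin.tail ((Fin.consEquiv fun _ : Fin (m + 1) => ZMod 2) (a, x)) = x := fun _ _ => rfl
      rw [List.ofFn_succ, List.prod_cons, h, ← (Fin.consEquiv fun _ => ZMod 2).sum_comp,
        Fintype.sum_prod_type]
      have hu : (univ : Finset (ZMod 2)) = {0, 1} := rfl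
      rw [hu, Finset.sum_pair (by decide), add_mul, one_mul, Finset.mul_sum]
      congr 1
      · refine Finset.sum_congr rfl fun x _ => ?_
        simp [Fintype.linearCombination_apply, Fin.sum_univ_succ, htail]
      · refine Finset.sum_congr rfl fun x _ => ?_
        simp [Fintype.linearCombination_apply, Fin.sum_univ_succ, pauliXZ_mul, smul_smul, htail]

namespace StabCode

variable {n m : ℕ} (S : StabCode n m)

/-- The binary span of the stabilizer generators. -/
def genSpan : Submodule (ZMod 2) (QIdx n × QIdx n) := Submodule.span (ZMod 2) (Set.range S.gen)

lemma range_linearCombination_gen :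
    LinearMap.range (Fintype.linearCombination (ZMod 2) S.gen) = S.genSpan :=
  Fintype.range_linearCombination _ _

lemma exists_proj_eq : ∃ φ : (Fin m → ZMod 2) → ℂ, (∀ x, ‖φ x‖ = 1) ∧
    S.proj = ((2 : ℂ) ^ m)⁻¹ • ∑ x, φ x •
      pauliXZ (Fintype.linearCombination (ZMod 2) S.gen x).1
        (Fintype.linearCombination (ZMod 2) S.gen x).2 := by
  obtain ⟨φ, hφ, h⟩ := exists_prod_one_add_pauliXZ S.gen S.sign fun i => by
    rcases S.sign_pm i with h | h <;> simp [h]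
  exact ⟨φ, hφ, by rw [proj, h]⟩

lemma trace_pauliXZ_mul_proj {v : QIdx n × QIdx n} (hv : v ∉ S.genSpan) :
    (pauliXZ v.1 v.2 * S.proj).trace = 0 := by
  obtain ⟨φ, -, h⟩ := S.exists_proj_eq
  rw [h, Matrix.mul_smul, Matrix.trace_smul, Finset.mul_sum, Matrix.trace_sum,
    Finset.sum_eq_zero, smul_zero]
  intro x _
  rw [Matrix.mul_smul, Matrix.trace_smul, pauliXZ_mul, Matrix.trace_smul, trace_pauliXZ, if_neg,
    smul_zero, smul_zero]
  rintro ⟨h1, h2⟩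
  have : v = Fintype.linearCombination (ZMod 2) S.gen x :=
    Prod.ext (funext fun i => CharTwo.add_eq_zero.mp (congrFun h1 i))
      (funext fun i => CharTwo.add_eq_zero.mp (congrFun h2 i))
  exact hv (this ▸ S.range_linearCombination_gen ▸ LinearMap.mem_range_self _ x)

lemma norm_trace_proj_le (h : n ≤ Module.finrank (ZMod 2) S.genSpan) : ‖S.proj.trace‖ ≤ 1 := by
  obtain ⟨φ, hφ, hp⟩ := S.exists_proj_eq
  set L := Fintype.linearCombination (ZMod 2) S.gen
  have hker : Module.finrank (ZMod 2) S.genSpan + Module.finrank (ZMod 2) (LinearMap.ker L) = m := by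
    rw [← S.range_linearCombination_gen, LinearMap.finrank_range_add_finrank_ker]
    simp
  have hcard : #{x | L x = 0} = 2 ^ Module.finrank (ZMod 2) (LinearMap.ker L) := by
    have := Module.card_eq_pow_finrank (K := ZMod 2) (V := LinearMap.ker L)
    rw [ZMod.card] at this
    rw [← this, ← Fintype.card_subtype]
    exact Fintype.card_congr (Equiv.refl _)
  have hsum : ‖∑ x, (φ x • pauliXZ (L x).1 (L x).2).trace‖ ≤ #{x | L x = 0} * (2 : ℝ) ^ n := by
    refine (norm_sum_le _ _).trans ?_
    have : ∀ x, ‖(φ x • pauliXZ (L x).1 (L x).2).trace‖ = if L x = 0 then (2 : ℝ) ^ n else 0 := by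
      intro x
      rw [Matrix.trace_smul, norm_smul, hφ, one_mul, trace_pauliXZ]
      simp only [Prod.ext_iff, Prod.fst_zero, Prod.snd_zero]
      split_ifs <;> simp
    rw [Finset.sum_congr rfl fun x _ => this x, ← Finset.sum_filter, sum_const, nsmul_eq_mul]
  rw [hp, Matrix.trace_smul, Matrix.trace_sum, norm_smul, norm_inv, norm_pow, Complex.norm_two,
    inv_mul_le_iff₀ (by positivity), mul_one]
  refine hsum.trans ?_
  rw [hcard]
  push_cast
  rw [← pow_add]
  exact pow_le_pow_right₀ one_le_two (by omega)

/-- Every Pauli operator supported on `U` and commuting with all generators lies, up to phase,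
in the stabilizer group. -/
def PauliCorrectable (U : Finset (Fin n)) : Prop :=
  ∀ v, (∀ i, symplForm n (S.gen i) v = 0) → pauliSupp v.1 v.2 ⊆ U → v ∈ S.genSpan

variable {S}

lemma PauliCorrectable.mono {U W : Finset (Fin n)} (hU : S.PauliCorrectable U) (h : W ⊆ U) :
    S.PauliCorrectable W :=
  fun v hv hs => hU v hv (hs.trans h)

lemma pauliCorrectable_of_card_lt {d k : ℕ} (hk : HasDim S k) (hd : HasDistanceGe S d)
    {U : Finset (Fin n)} (hU : #U < d) : S.PauliCorrectable U := by
  intro v hv hs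
  by_contra hvG
  have htr : S.proj.trace ≠ 0 := by
    rw [HasDim] at hk
    simp [hk]
  have hne : S.proj ≠ 0 := fun h => htr (by simp [h])
  obtain ⟨z₀, hz₀⟩ := hd 0 0 (by
    have : pauliSupp (0 : QIdx n) 0 = ∅ := by simp [pauliSupp]
    rw [this, card_empty]
    omega)
  rw [pauliXZ_zero, mul_one] at hz₀
  obtain ⟨z, hz⟩ := hd v.1 v.2 ((card_le_card hs).trans_lt hU)
  have hcomm : Commute (pauliXZ v.1 v.2) S.proj := by
    refine Commute.smul_right (Commute.list_prod_right _ _ fun x hx => ?_) _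
    obtain ⟨i, rfl⟩ := (List.mem_ofFn' _ _).mp hx
    refine (Commute.one_right _).add_right (Commute.smul_right ?_ _)
    exact pauliXZ_commute (by rw [symplForm_comm, hv])
  rw [← hcomm.eq, mul_assoc, hz₀, Matrix.mul_smul] at hz
  have hz0 : z = 0 := by
    have := congrArg Matrix.trace hz
    rw [Matrix.trace_smul, Matrix.trace_smul, S.trace_pauliXZ_mul_proj hvG, smul_zero,
      smul_eq_mul] at this
    exact (mul_eq_zero.mp this.symm).resolve_right htr
  have hz₀0 : z₀ ≠ 0 := by
    rintro rfl
    have : IsNilpotent S.proj := ⟨2, by rw [pow_two, hz₀, zero_smul]⟩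
    exact htr (Matrix.isNilpotent_trace_of_isNilpotent this).eq_zero
  rw [hz0, zero_smul] at hz
  have hEP := (smul_eq_zero.mp hz).resolve_left hz₀0
  have hEEP := congrArg (pauliXZ v.1 v.2 * ·) hEP
  simp only [← mul_assoc, pauliXZ_mul_self, mul_zero, smul_mul_assoc, one_mul] at hEEP
  exact hne ((smul_eq_zero.mp hEEP).resolve_left (zmodTwoSign_ne_zero _))

lemma not_pauliCorrectable_univ {k : ℕ} (hk : HasDim S k) (hk1 : 1 ≤ k) :
    ¬ S.PauliCorrectable univ := by
  intro h
  have hle : (symplForm n).orthogonal S.genSpan ≤ S.genSpan := by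
    intro v hv
    refine h v (fun i => ?_) (subset_univ _)
    exact hv _ (Submodule.subset_span ⟨i, rfl⟩)
  have hfin := Submodule.finrank_mono hle
  rw [LinearMap.BilinForm.finrank_orthogonal (symplForm_nondegenerate n)] at hfin
  simp only [Module.finrank_prod, Module.finrank_fin_fun] at hfin
  have htr := S.norm_trace_proj_le (by omega)
  rw [HasDim] at hk
  rw [hk, norm_pow, Complex.norm_two] at htr
  have : (2 : ℝ) ^ 1 ≤ 2 ^ k := pow_le_pow_right₀ one_le_two hk1
  linarith

/-- Restriction of a Pauli label to a set of qubits. -/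
noncomputable def restrictPauli (U : Finset (Fin n)) (v : QIdx n × QIdx n) : QIdx n × QIdx n :=
  (fun i => if i ∈ U then v.1 i else 0, fun i => if i ∈ U then v.2 i else 0)

lemma mem_pauliSupp {a b : QIdx n} {i : Fin n} : i ∈ pauliSupp a b ↔ a i ≠ 0 ∨ b i ≠ 0 := by
  simp [pauliSupp]

lemma notMem_pauliSupp {a b : QIdx n} {i : Fin n} : i ∉ pauliSupp a b ↔ a i = 0 ∧ b i = 0 := by
  simp [pauliSupp]

lemma pauliSupp_restrictPauli_subset (U : Finset (Fin n)) (v : QIdx n × QIdx n) :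
    pauliSupp (restrictPauli U v).1 (restrictPauli U v).2 ⊆ U := by
  intro i hi
  by_contra hiU
  simp [mem_pauliSupp, restrictPauli, hiU] at hi

lemma restrictPauli_add_restrictPauli {U W : Finset (Fin n)} (hUW : Disjoint U W)
    {v : QIdx n × QIdx n} (hv : pauliSupp v.1 v.2 ⊆ U ∪ W) :
    restrictPauli U v + restrictPauli W v = v := by
  have key : ∀ i, i ∉ U → i ∉ W → v.1 i = 0 ∧ v.2 i = 0 := fun i hU hW =>
    notMem_pauliSupp.mp fun hi => (mem_union.mp (hv hi)).elim hU hW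
  have hdisj : ∀ i, i ∈ U → i ∉ W := fun i hi => Finset.disjoint_left.mp hUW hi
  ext i <;> by_cases hU : i ∈ U <;> by_cases hW : i ∈ W <;>
    simp_all [restrictPauli]

lemma symplForm_eq_zero_of_disjoint {v w : QIdx n × QIdx n}
    (h : Disjoint (pauliSupp v.1 v.2) (pauliSupp w.1 w.2)) : symplForm n v w = 0 := by
  rw [symplForm_apply]
  refine Finset.sum_eq_zero fun i _ => ?_
  by_cases hi : i ∈ pauliSupp v.1 v.2
  · have := notMem_pauliSupp.mp (Finset.disjoint_left.mp h hi)
    simp [this]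
  · simp [notMem_pauliSupp.mp hi]

lemma connGraph_adj_of_mem {i : Fin m} {u v : Fin n} (huv : u ≠ v)
    (hu : u ∈ pauliSupp (S.gen i).1 (S.gen i).2) (hv : v ∈ pauliSupp (S.gen i).1 (S.gen i).2) :
    (connGraph S).Adj u v := by
  rw [connGraph, SimpleGraph.fromRel_adj]
  exact ⟨huv, Or.inl ⟨i, hu, hv⟩⟩

lemma PauliCorrectable.union {U W : Finset (Fin n)} (hU : S.PauliCorrectable U)
    (hW : S.PauliCorrectable W) (hdisj : Disjoint U W) (hUW : Disconn (connGraph S) U W) :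
    S.PauliCorrectable (U ∪ W) := by
  intro v hv hs
  have hsum := restrictPauli_add_restrictPauli hdisj hs
  have hsuppU := pauliSupp_restrictPauli_subset U v
  have hsuppW := pauliSupp_restrictPauli_subset W v
  have key : ∀ i, symplForm n (S.gen i) (restrictPauli U v) = 0 ∧
      symplForm n (S.gen i) (restrictPauli W v) = 0 := by
    intro i
    have hadd : symplForm n (S.gen i) (restrictPauli U v) +
        symplForm n (S.gen i) (restrictPauli W v) = 0 := by
      rw [← map_add, hsum, hv]
    by_cases hi : Disjoint (pauliSupp (S.gen i).1 (S.gen i).2) U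
    · have h0 := symplForm_eq_zero_of_disjoint (hi.mono_right hsuppU)
      exact ⟨h0, by simpa [h0] using hadd⟩
    · obtain ⟨u, hu, huU⟩ := Finset.not_disjoint_iff.mp hi
      have hiW : Disjoint (pauliSupp (S.gen i).1 (S.gen i).2) W :=
        Finset.disjoint_left.mpr fun w hw hwW => hUW u huU w hwW <|
          connGraph_adj_of_mem (fun h => Finset.disjoint_left.mp hdisj huU (h ▸ hwW)) hu hw
      have h0 := symplForm_eq_zero_of_disjoint (hiW.mono_right hsuppW)
      exact ⟨by simpa [h0] using hadd, h0⟩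
  rw [← hsum]
  exact add_mem (hU _ (fun i => (key i).1) hsuppU) (hW _ (fun i => (key i).2) hsuppW)

/-- Pauli labels acting trivially on `U`. -/
def trivialOn (U : Finset (Fin n)) : Submodule (ZMod 2) (QIdx n × QIdx n) where
  carrier := {v | ∀ i ∈ U, v.1 i = 0 ∧ v.2 i = 0}
  add_mem' hv hw i hi := by simp [hv i hi, hw i hi]
  zero_mem' := by simp
  smul_mem' r v hv i hi := by simp [hv i hi]

lemma mem_trivialOn {U : Finset (Fin n)} {v : QIdx n × QIdx n} :
    v ∈ trivialOn U ↔ ∀ i ∈ U, v.1 i = 0 ∧ v.2 i = 0 :=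
  Iff.rfl

variable (S) in
/-- The binary span of the generators acting nontrivially on some qubit of `U`. -/
def touchingSpan (U : Finset (Fin n)) : Submodule (ZMod 2) (QIdx n × QIdx n) :=
  Submodule.span (ZMod 2) (S.gen '' {i | ¬ Disjoint (pauliSupp (S.gen i).1 (S.gen i).2) U})

lemma touchingSpan_le_genSpan (U : Finset (Fin n)) : S.touchingSpan U ≤ S.genSpan :=
  Submodule.span_mono (Set.image_subset_range _ _)

lemma symplForm_gen_eq_zero_of_mem_genSpan {v : QIdx n × QIdx n} (hv : v ∈ S.genSpan)
    (i : Fin m) : symplForm n (S.gen i) v = 0 := by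
  have : S.genSpan ≤ LinearMap.ker (symplForm n (S.gen i)) := by
    refine Submodule.span_le.mpr ?_
    rintro _ ⟨j, rfl⟩
    rw [SetLike.mem_coe, LinearMap.mem_ker, symplForm_apply, S.commute]
  exact this hv

lemma eq_zero_of_mem_touchingSpan {U : Finset (Fin n)} {g : QIdx n × QIdx n}
    (hg : g ∈ S.touchingSpan U) {j : Fin n} (hj : j ∉ U)
    (hj' : j ∉ outerBoundary (connGraph S) U) : g.1 j = 0 ∧ g.2 j = 0 := by
  have : S.touchingSpan U ≤ trivialOn {j} := by
    refine Submodule.span_le.mpr ?_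
    rintro _ ⟨i, hi, rfl⟩
    obtain ⟨u, hu, huU⟩ := Finset.not_disjoint_iff.mp hi
    simp only [SetLike.mem_coe, mem_trivialOn, mem_singleton, forall_eq]
    refine notMem_pauliSupp.mp fun hji => hj' ?_
    simp only [outerBoundary, mem_filter, mem_univ, true_and]
    exact ⟨hj, u, huU, connGraph_adj_of_mem (fun h => hj (h ▸ huU)) hu hji⟩
  exact this hg j (mem_singleton_self j)

/-- Cleaning lemma: a logical Pauli operator can be moved off a correctable set by multiplying
with generators that touch the set. -/
lemma PauliCorrectable.mem_touchingSpan_sup_trivialOn {U : Finset (Fin n)}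
    (hU : S.PauliCorrectable U) {v : QIdx n × QIdx n}
    (hv : ∀ i, symplForm n (S.gen i) v = 0) : v ∈ S.touchingSpan U ⊔ trivialOn U := by
  rw [← LinearMap.BilinForm.orthogonal_orthogonal (symplForm_nondegenerate n) (symplForm_isRefl n)
    (S.touchingSpan U ⊔ trivialOn U)]
  intro w hw
  have hwtriv : ∀ y ∈ trivialOn U, symplForm n y w = 0 := fun y hy =>
    hw y (Submodule.mem_sup_right hy)
  have hwsupp : pauliSupp w.1 w.2 ⊆ U := by
    intro i hi
    by_contra hiU
    refine notMem_pauliSupp.mpr ⟨?_, ?_⟩ hi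
    · rw [← symplForm_single_right]
      refine hwtriv _ fun j hj => ?_
      simp [show j ≠ i from fun h => hiU (h ▸ hj)]
    · rw [← symplForm_single_left]
      refine hwtriv _ fun j hj => ?_
      simp [show j ≠ i from fun h => hiU (h ▸ hj)]
  have hwgen : ∀ i, symplForm n (S.gen i) w = 0 := by
    intro i
    by_cases hi : Disjoint (pauliSupp (S.gen i).1 (S.gen i).2) U
    · exact symplForm_eq_zero_of_disjoint (hi.mono_right hwsupp)
    · exact hw _ (Submodule.mem_sup_left (Submodule.subset_span ⟨i, hi, rfl⟩))
  have hle : S.genSpan ≤ LinearMap.ker ((symplForm n).flip v) := by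
    refine Submodule.span_le.mpr ?_
    rintro _ ⟨i, rfl⟩
    exact hv i
  exact hle (hU w hwgen hwsupp)

lemma PauliCorrectable.expand {U T : Finset (Fin n)} (hU : S.PauliCorrectable U)
    (hT : S.PauliCorrectable T) (hUT : outerBoundary (connGraph S) U ⊆ T) :
    S.PauliCorrectable (U ∪ T) := by
  intro v hv hs
  obtain ⟨g, hg, y, hy, rfl⟩ := Submodule.mem_sup.mp (hU.mem_touchingSpan_sup_trivialOn hv)
  have hgS := touchingSpan_le_genSpan U hg
  refine add_mem hgS (hT y (fun i => ?_) fun j hj => ?_)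
  · simpa [symplForm_gen_eq_zero_of_mem_genSpan hgS i] using hv i
  · by_contra hjT
    have hjU : j ∉ U := fun h => notMem_pauliSupp.mpr (hy j h) hj
    have hg0 := eq_zero_of_mem_touchingSpan hg hjU fun h => hjT (hUT h)
    have hjv : j ∈ pauliSupp (g + y).1 (g + y).2 := by
      simpa [mem_pauliSupp, hg0] using hj
    exact (mem_union.mp (hs hjv)).elim hjU hjT

end StabCode

lemma outerBoundary_subset_of_disconn {V : Type*} [Fintype V] [DecidableEq V] {G : SimpleGraph V}
    {T U W : Finset V} (hUW : Disconn G U W) :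
    outerBoundary G U ⊆ T ∪ outerBoundary G (T ∪ U ∪ W) := by
  intro x hx
  simp only [outerBoundary, mem_filter, mem_univ, true_and, mem_union] at hx ⊢
  obtain ⟨hxU, u, hu, hux⟩ := hx
  have hxW : x ∉ W := fun h => hUW u hu x h hux
  by_cases hxT : x ∈ T
  · exact Or.inl hxT
  · exact Or.inr ⟨by tauto, u, by tauto, hux⟩

/-- In a graph with separation profile `β r ^ c`, a vertex set whose size and outer boundary are
small compared to `d` belongs to every family closed under the correctability rules. -/
lemma correctable_of_hasSepProfile {V : Type*} [Fintype V] [DecidableEq V] {G : SimpleGraph V}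
    {β c C : ℝ} {d : ℕ} (hβ : 0 ≤ β) (hc : 0 < c) (hC : 1 + C * (2 / 3) ^ c ≤ C) (hC1 : 1 ≤ C)
    (hsep : HasSepProfile G β c) {F : Finset V → Prop}
    (mono : ∀ {U W}, F U → W ⊆ U → F W) (small : ∀ {U : Finset V}, #U < d → F U)
    (union : ∀ {U W}, F U → F W → Disjoint U W → Disconn G U W → F (U ∪ W))
    (expand : ∀ {U T}, F U → F T → outerBoundary G U ⊆ T → F (U ∪ T)) (H : Finset V)
    (hH : (#(outerBoundary G H) : ℝ) + C * (β * (#H : ℝ) ^ c) < d) : F H := by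
  induction hN : #H using Nat.strong_induction_on generalizing H with
  | _ N ih =>
  obtain ⟨T, U, W, rfl, -, -, hUW, hdis, hUcard, hWcard, hTcard⟩ := hsep H
  set H := T ∪ U ∪ W
  have hpow : (0 : ℝ) ≤ β * (#H : ℝ) ^ c := by positivity
  rcases Nat.eq_zero_or_pos (#H) with h0 | hpos
  · refine small ?_
    have : (0 : ℝ) < d := by
      have : 0 ≤ C * (β * (#H : ℝ) ^ c) := by positivity
      have : (0 : ℝ) ≤ #(outerBoundary G H) := by positivity
      linarith
    rw [h0]
    exact_mod_cast this
  have hrec : ∀ U' : Finset V, outerBoundary G U' ⊆ T ∪ outerBoundary G H →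
      3 * #U' ≤ 2 * #H → F U' := by
    intro U' hbd hcard
    refine ih _ (by omega) U' ?_ rfl
    have hbd' : (#(outerBoundary G U') : ℝ) ≤ #T + #(outerBoundary G H) := by
      exact_mod_cast (card_le_card hbd).trans (card_union_le _ _)
    have hle : (#U' : ℝ) ≤ 2 / 3 * #H := by
      have : (3 : ℝ) * #U' ≤ 2 * #H := by exact_mod_cast hcard
      linarith
    have hle' : (#U' : ℝ) ^ c ≤ (2 / 3) ^ c * (#H : ℝ) ^ c := by
      rw [← Real.mul_rpow (by norm_num) (by positivity)]
      exact Real.rpow_le_rpow (by positivity) hle hc.le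
    have h1 : C * (β * (#U' : ℝ) ^ c) ≤ C * (β * ((2 / 3) ^ c * (#H : ℝ) ^ c)) := by gcongr
    have h2 := mul_le_mul_of_nonneg_right hC hpow
    nlinarith
  have hU : F U := hrec U (outerBoundary_subset_of_disconn hdis) hUcard
  have hW : F W := by
    refine hrec W ?_ hWcard
    have : H = T ∪ W ∪ U := union_right_comm T U W
    rw [this]
    exact outerBoundary_subset_of_disconn fun a ha b hb hab => hdis b hb a ha hab.symm
  have hsmall : F (T ∪ outerBoundary G H) := by
    refine small ?_
    have h1 : (#(T ∪ outerBoundary G H) : ℝ) ≤ #T + #(outerBoundary G H) := by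
      exact_mod_cast card_union_le _ _
    have h2 := mul_le_mul_of_nonneg_right hC1 hpow
    have : (#(T ∪ outerBoundary G H) : ℝ) < d := by linarith
    exact_mod_cast this
  refine mono (expand (union hU hW hUW hdis) hsmall ?_) ?_
  · have : H = T ∪ (U ∪ W) ∪ ∅ := by rw [union_empty, ← union_assoc]
    rw [this]
    exact outerBoundary_subset_of_disconn fun a _ b hb => absurd hb (notMem_empty b)
  · intro x hx
    simp only [H, mem_union] at hx ⊢
    tauto

/-- degree-oblivious distance bound: for `β ≥ 1`, `c ∈ (0,1)` there is
`α = α(β,c) > 0` such that any `⟦n,k,d⟧` stabilizer code with `k ≥ 1` whose connectivity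
graph has separation profile `s_G(r) ≤ β r^c` satisfies `d ≤ α·n^c`. -/
theorem distance_bound (β c : ℝ) (hβ : 1 ≤ β) (hc0 : 0 < c) (hc1 : c < 1) :
    ∃ α : ℝ, 0 < α ∧
      ∀ (n m k d : ℕ) (S : StabCode n m), 1 ≤ k →
        HasDim S k → HasDistanceGe S d → HasSepProfile (connGraph S) β c →
        (d : ℝ) ≤ α * (n : ℝ) ^ c := by
  have hlt : (2 / 3 : ℝ) ^ c < 1 := Real.rpow_lt_one (by norm_num) (by norm_num) hc0
  have hpos : (0 : ℝ) < (2 / 3 : ℝ) ^ c := by positivity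
  have hden : 0 < 1 - (2 / 3 : ℝ) ^ c := by linarith
  set C : ℝ := (1 - (2 / 3 : ℝ) ^ c)⁻¹
  have hC1 : 1 ≤ C := one_le_inv_iff₀.mpr ⟨hden, by linarith⟩
  have hC : 1 + C * (2 / 3) ^ c ≤ C := by
    have : C * (1 - (2 / 3 : ℝ) ^ c) = 1 := inv_mul_cancel₀ hden.ne'
    linarith
  refine ⟨C * β, by positivity, fun n m k d S hk hdim hdist hsep => ?_⟩
  by_contra! hd
  refine StabCode.not_pauliCorrectable_univ hdim hk ?_
  refine correctable_of_hasSepProfile (d := d) (by linarith) hc0 hC hC1 hsep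
    StabCode.PauliCorrectable.mono (StabCode.pauliCorrectable_of_card_lt hdim hdist)
    StabCode.PauliCorrectable.union StabCode.PauliCorrectable.expand univ ?_
  have : outerBoundary (connGraph S) univ = ∅ := by simp [outerBoundary]
  rw [this, card_empty, Nat.cast_zero, zero_add, card_univ, Fintype.card_fin, ← mul_assoc]
  exact hd
end

section
/- Let β ≥ 1 and c ∈ (0,1). There exists α = α(β,c) > 0 such that for all n ≥ d, any graph G on n vertices with s_G(r) ≤ β·r^c for all r contains a d-correctable set A with |V∖A| ≤ α·n/d^{(1−c)/c}. -/
open scoped Classical ComplexOrder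
open Finset

theorem mem_outerBoundary {V : Type*} [Fintype V] {G : SimpleGraph V} {U : Finset V}
    {v : V} :
    v ∈ outerBoundary G U ↔ v ∉ U ∧ ∃ u ∈ U, G.Adj u v := by
  simp [outerBoundary]

section Correctable

variable {V : Type*} [Fintype V] [DecidableEq V] {G : SimpleGraph V} {d : ℕ}

theorem IsCorrectableSet.mono {U W : Finset V} (hU : IsCorrectableSet G d U) (h : W ⊆ U) :
    IsCorrectableSet G d W :=
  fun F hF => hF.1 U (hU F hF) W h

theorem isCorrectableSet_of_card_lt {U : Finset V} (h : U.card < d) : IsCorrectableSet G d U :=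
  fun _ hF => hF.2.1 U h

theorem IsCorrectableSet.union {U W : Finset V} (hU : IsCorrectableSet G d U)
    (hW : IsCorrectableSet G d W) (hd : Disjoint U W) (hc : Disconn G U W) :
    IsCorrectableSet G d (U ∪ W) := by
  intro F hF
  have key := hF.2.2.1 2 ![U, W]
    (by intro i; fin_cases i <;> simp [hU F hF, hW F hF])
    (by
      intro i j hij
      fin_cases i <;> fin_cases j
      · exact absurd rfl hij
      · exact ⟨hd, hc⟩
      · exact ⟨hd.symm, fun a ha b hb hab => hc b hb a ha hab.symm⟩
      · exact absurd rfl hij)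
  refine hF.1 _ key _ ?_
  intro x hx
  rw [mem_biUnion]
  rcases mem_union.1 hx with h | h
  · exact ⟨0, mem_univ _, h⟩
  · exact ⟨1, mem_univ _, h⟩

theorem IsCorrectableSet.expand {U T : Finset V} (hU : IsCorrectableSet G d U)
    (hT : IsCorrectableSet G d T) (h : outerBoundary G U ⊆ T) : IsCorrectableSet G d (U ∪ T) :=
  fun F hF => hF.2.2.2 U (hU F hF) T (hT F hF) h

end Correctable

theorem rpow_card_le {a h c ρ : ℝ} (ha : 0 ≤ a) (hρ : 0 ≤ ρ) (hh : 0 ≤ h) (hc : 0 ≤ c)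
    (hle : a ≤ ρ * h) : a ^ c ≤ ρ ^ c * h ^ c := by
  rw [← Real.mul_rpow hρ hh]
  exact Real.rpow_le_rpow ha hle hc

/-- A set `U` whose outer boundary is small compared to `d`, with room for the total size of
all separators in a recursive dissection of `U`, is `d`-correctable. -/
theorem isCorrectableSet_of_boundary {V : Type*} [Fintype V] [DecidableEq V]
    {G : SimpleGraph V} {d : ℕ} {β c K : ℝ} (hc : 0 < c)
    (hK : β + K * (3 / 4 : ℝ) ^ c ≤ K) (hK0 : 0 ≤ K) (hG : HasSepProfile G β c)
    (U : Finset V) (hU : ((outerBoundary G U).card : ℝ) + K * (U.card : ℝ) ^ c < d) :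
    IsCorrectableSet G d U := by
  induction hn : U.card using Nat.strong_induction_on generalizing U with
  | _ n ih =>
  subst hn
  rcases U.eq_empty_or_nonempty with rfl | hne
  · apply isCorrectableSet_of_card_lt
    have : (0 : ℝ) < d := lt_of_le_of_lt (by positivity) hU
    simpa using this
  obtain ⟨T, U₁, U₂, hH, hT1, hT2, h12, hdis, hc1, hc2, hTc⟩ := hG U
  have hpos : 0 < U.card := hne.card_pos
  have hsub : ∀ W : Finset V, outerBoundary G W ⊆ T ∪ outerBoundary G U →
      3 * W.card ≤ 2 * U.card → IsCorrectableSet G d W := by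
    intro W hWB hW
    refine ih W.card (by omega) W ?_ rfl
    have h1 : ((outerBoundary G W).card : ℝ) ≤ T.card + (outerBoundary G U).card := by
      exact_mod_cast (card_le_card hWB).trans (card_union_le _ _)
    have h2 : (W.card : ℝ) ^ c ≤ (3 / 4 : ℝ) ^ c * (U.card : ℝ) ^ c := by
      apply rpow_card_le (by positivity) (by norm_num) (by positivity) hc.le
      have : (3 : ℝ) * W.card ≤ 2 * U.card := by exact_mod_cast hW
      have : (0 : ℝ) ≤ U.card := by positivity
      linarith
    have h3 : (0 : ℝ) ≤ (U.card : ℝ) ^ c := by positivity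
    nlinarith [mul_le_mul_of_nonneg_left h2 hK0, mul_le_mul_of_nonneg_right hK h3]
  have hm : ∀ x, x ∈ U ↔ (x ∈ T ∨ x ∈ U₁) ∨ x ∈ U₂ := by
    intro x; rw [← hH, mem_union, mem_union]
  have hb1 : outerBoundary G U₁ ⊆ T ∪ outerBoundary G U := by
    intro v hv
    rw [mem_outerBoundary] at hv
    obtain ⟨hv1, u, hu, huv⟩ := hv
    have := hdis u hu v
    rw [mem_union, mem_outerBoundary, hm]
    by_cases hvT : v ∈ T
    · exact Or.inl hvT
    · refine Or.inr ⟨by tauto, u, (hm u).2 (by tauto), huv⟩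
  have hb2 : outerBoundary G U₂ ⊆ T ∪ outerBoundary G U := by
    intro v hv
    rw [mem_outerBoundary] at hv
    obtain ⟨hv1, u, hu, huv⟩ := hv
    have := fun h => hdis v h u hu huv.symm
    rw [mem_union, mem_outerBoundary, hm]
    by_cases hvT : v ∈ T
    · exact Or.inl hvT
    · refine Or.inr ⟨by tauto, u, (hm u).2 (by tauto), huv⟩
  have g1 := hsub U₁ hb1 hc1
  have g2 := hsub U₂ hb2 hc2
  have gT : IsCorrectableSet G d (T ∪ outerBoundary G U) := by
    apply isCorrectableSet_of_card_lt
    have h1 : ((T ∪ outerBoundary G U).card : ℝ) ≤ T.card + (outerBoundary G U).card := by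
      exact_mod_cast card_union_le _ _
    have h3 : (0 : ℝ) ≤ (U.card : ℝ) ^ c := by positivity
    have h4 : 0 ≤ K * (3 / 4 : ℝ) ^ c := by positivity
    have h5 : β * (U.card : ℝ) ^ c ≤ K * (U.card : ℝ) ^ c :=
      mul_le_mul_of_nonneg_right (by linarith) h3
    have : ((T ∪ outerBoundary G U).card : ℝ) < d := by linarith
    exact_mod_cast this
  refine ((g1.union g2 h12 hdis).expand gT ?_).mono ?_
  · intro v hv
    rw [mem_outerBoundary] at hv
    obtain ⟨hv, u, hu, huv⟩ := hv
    rw [mem_union] at hv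
    rcases mem_union.1 hu with hu | hu
    · exact hb1 (mem_outerBoundary.2 ⟨by tauto, u, hu, huv⟩)
    · exact hb2 (mem_outerBoundary.2 ⟨by tauto, u, hu, huv⟩)
  · intro x hx
    have := (hm x).1 hx
    simp only [mem_union]
    tauto

/-- `B` is contained in `H` and contains every neighbour of `H \ B` lying outside `H \ B`. -/
def Encloses {V : Type*} [DecidableEq V] (G : SimpleGraph V) (H B : Finset V) : Prop :=
  B ⊆ H ∧ ∀ u ∈ H \ B, ∀ v, G.Adj u v → v ∈ H

/-- The set `B` can be enlarged by at most `x` vertices of `H` to a set whose complement in `H`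
is `d`-correctable. -/
def HasCut {V : Type*} [Fintype V] [DecidableEq V] (G : SimpleGraph V) (d : ℕ)
    (H B : Finset V) (x : ℝ) : Prop :=
  ∃ S : Finset V, B ⊆ S ∧ S ⊆ H ∧ IsCorrectableSet G d (H \ S) ∧ ((S \ B).card : ℝ) ≤ x

section Cut

variable {V : Type*} [Fintype V] [DecidableEq V] {G : SimpleGraph V} {d : ℕ}

theorem HasCut.mono {H B : Finset V} {x y : ℝ} (h : HasCut G d H B x) (hxy : x ≤ y) :
    HasCut G d H B y := by
  obtain ⟨S, h1, h2, h3, h4⟩ := h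
  exact ⟨S, h1, h2, h3, h4.trans hxy⟩

theorem Encloses.outerBoundary_subset {H B : Finset V} (h : Encloses G H B) :
    outerBoundary G (H \ B) ⊆ B := by
  intro v hv
  rw [mem_outerBoundary] at hv
  obtain ⟨hv, u, hu, huv⟩ := hv
  have := h.2 u hu v huv
  rw [mem_sdiff] at hv
  tauto

/-- Separating a region `H` with boundary `B` gives two overlapping regions sharing the
separator, which is added to both boundaries. -/
theorem Encloses.split {H B : Finset V} {s : ℝ} (hHB : Encloses G H B) (hs : SepUpTo G H s) :
    ∃ (t : ℕ) (H₁ B₁ H₂ B₂ : Finset V), (t : ℝ) ≤ s ∧ Encloses G H₁ B₁ ∧ Encloses G H₂ B₂ ∧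
      H₁.card + H₂.card = H.card + t ∧ B₁.card + B₂.card ≤ B.card + 2 * t ∧
      B₁.card ≤ B.card + t ∧ B₂.card ≤ B.card + t ∧
      3 * H₁.card ≤ 2 * H.card + 3 * t ∧ 3 * H₂.card ≤ 2 * H.card + 3 * t ∧
      H.card ≤ 3 * H₁.card ∧ H.card ≤ 3 * H₂.card ∧
      ∀ x₁ x₂ : ℝ, HasCut G d H₁ B₁ x₁ → HasCut G d H₂ B₂ x₂ →
        HasCut G d H B (x₁ + x₂ + t) := by
  obtain ⟨T, U₁, U₂, hH, hT1, hT2, h12, hdis, hc1, hc2, hTc⟩ := hs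
  obtain ⟨hBH, hN⟩ := hHB
  have hm : ∀ x, x ∈ H ↔ (x ∈ T ∨ x ∈ U₁) ∨ x ∈ U₂ := by
    intro x; rw [← hH, mem_union, mem_union]
  have hcard : H.card = T.card + U₁.card + U₂.card := by
    rw [← hH, card_union_of_disjoint, card_union_of_disjoint hT1]
    exact disjoint_union_left.2 ⟨hT2, h12⟩
  have e1 : (U₁ ∪ T).card = U₁.card + T.card := card_union_of_disjoint hT1.symm
  have e2 : (U₂ ∪ T).card = U₂.card + T.card := card_union_of_disjoint hT2.symm
  have f1 : (B ∩ U₁ ∪ T).card ≤ (B ∩ U₁).card + T.card := card_union_le _ _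
  have f2 : (B ∩ U₂ ∪ T).card ≤ (B ∩ U₂).card + T.card := card_union_le _ _
  have f3 : (B ∩ U₁).card + (B ∩ U₂).card ≤ B.card := by
    rw [← card_union_of_disjoint]
    · exact card_le_card (union_subset inter_subset_left inter_subset_left)
    · exact h12.mono inter_subset_right inter_subset_right
  refine ⟨T.card, U₁ ∪ T, B ∩ U₁ ∪ T, U₂ ∪ T, B ∩ U₂ ∪ T, hTc, ⟨?_, ?_⟩, ⟨?_, ?_⟩,
    by omega, by omega, by omega, by omega, by omega, by omega, by omega, by omega, ?_⟩
  · exact union_subset_union_left inter_subset_right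
  · intro u hu v huv
    simp only [mem_sdiff, mem_union, mem_inter] at hu ⊢
    have h1 := hN u (by rw [mem_sdiff, hm]; tauto) v huv
    have h2 := hdis u (by tauto) v
    have := hm v
    tauto
  · exact union_subset_union_left inter_subset_right
  · intro u hu v huv
    simp only [mem_sdiff, mem_union, mem_inter] at hu ⊢
    have h1 := hN u (by rw [mem_sdiff, hm]; tauto) v huv
    have h2 := fun h => hdis v h u (by tauto) huv.symm
    have := hm v
    tauto
  · rintro x₁ x₂ ⟨S₁, a1, b1, c1, d1⟩ ⟨S₂, a2, b2, c2, d2⟩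
    have hu1 : (U₁ ∪ T) \ S₁ ⊆ U₁ := by
      intro x hx
      have := @a1 x
      simp only [mem_sdiff, mem_union] at hx this
      tauto
    have hu2 : (U₂ ∪ T) \ S₂ ⊆ U₂ := by
      intro x hx
      have := @a2 x
      simp only [mem_sdiff, mem_union] at hx this
      tauto
    refine ⟨S₁ ∪ S₂, ?_, ?_, ?_, ?_⟩
    · intro x hx
      have h1 := @a1 x
      have h2 := @a2 x
      have h3 := (hm x).1 (hBH hx)
      simp only [mem_union, mem_inter] at h1 h2 ⊢
      tauto
    · intro x hx
      have h1 := @b1 x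
      have h2 := @b2 x
      rw [hm]
      simp only [mem_union] at h1 h2 hx
      tauto
    · refine (c1.union c2 (h12.mono hu1 hu2)
        fun a ha b hb => hdis a (hu1 ha) b (hu2 hb)).mono ?_
      intro x hx
      have := hm x
      simp only [mem_sdiff, mem_union] at hx ⊢
      tauto
    · have hsub : (S₁ ∪ S₂) \ B ⊆ S₁ \ (B ∩ U₁ ∪ T) ∪ S₂ \ (B ∩ U₂ ∪ T) ∪ T := by
        intro x hx
        simp only [mem_sdiff, mem_union, mem_inter] at hx ⊢
        tauto
      have h1 := (card_le_card hsub).trans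
        ((card_union_le _ _).trans (Nat.add_le_add_right (card_union_le _ _) _))
      have h2 : (((S₁ ∪ S₂) \ B).card : ℝ) ≤
          (S₁ \ (B ∩ U₁ ∪ T)).card + (S₂ \ (B ∩ U₂ ∪ T)).card + T.card := by
        exact_mod_cast h1
      linarith

/-- A region of size `O(d ^ (1 / c))` with boundary `B` is made correctable by removing few
vertices, and none at all if `B` is small. -/
theorem Encloses.hasCut_of_small {β c K h₀ : ℝ} (hc : 0 < c) (hβ : 0 ≤ β)
    (hK : 2 * β + K * (3 / 4 : ℝ) ^ c ≤ K) (hKβ : 3 * β ≤ K) (hG : HasSepProfile G β c)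
    (hh₀ : ∀ h : ℝ, h₀ ≤ h → 12 * (β * h ^ c) ≤ h) (hd : 2 * h₀ ≤ d) (hd0 : 0 < d)
    (H B : Finset V) (hHB : Encloses G H B) (hH : 16 * (K * (H.card : ℝ) ^ c) ≤ d) :
    HasCut G d H B
      (if (B.card : ℝ) < d / 2 then 0 else B.card - d / 4 + K * (H.card : ℝ) ^ c) := by
  induction hn : H.card using Nat.strong_induction_on generalizing H B with
  | _ n ih =>
  subst hn
  have hd0' : (0 : ℝ) < d := by exact_mod_cast hd0
  have hK0 : 0 ≤ K := by linarith
  have hσ : (0 : ℝ) ≤ (3 / 4 : ℝ) ^ c := by positivity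
  have hHc : (0 : ℝ) ≤ (H.card : ℝ) ^ c := by positivity
  by_cases hb : (B.card : ℝ) < d / 2
  · rw [if_pos hb]
    refine ⟨B, Subset.rfl, hHB.1, ?_, by simp⟩
    apply isCorrectableSet_of_boundary hc (by linarith) hK0 hG
    have h1 : ((outerBoundary G (H \ B)).card : ℝ) ≤ B.card := by
      exact_mod_cast card_le_card hHB.outerBoundary_subset
    have h2 : ((H \ B).card : ℝ) ^ c ≤ (H.card : ℝ) ^ c :=
      Real.rpow_le_rpow (by positivity)
        (by exact_mod_cast card_le_card sdiff_subset) hc.le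
    have h3 := mul_le_mul_of_nonneg_left h2 hK0
    linarith
  · rw [if_neg hb]
    push Not at hb
    obtain ⟨t, H₁, B₁, H₂, B₂, ht, g1, g2, k1, k2, k3, k4, k5, k6, k7, k8, hcut⟩ :=
      hHB.split (d := d) (hG H)
    have hBH : (B.card : ℝ) ≤ H.card := by exact_mod_cast card_le_card hHB.1
    have h12 := hh₀ H.card (by linarith)
    have hHpos : (0 : ℝ) < H.card := by linarith
    have ht0 : (0 : ℝ) ≤ t := by positivity
    have child : ∀ W D : Finset V, Encloses G W D → 3 * W.card ≤ 2 * H.card + 3 * t →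
        K * (W.card : ℝ) ^ c ≤ K * ((3 / 4 : ℝ) ^ c * (H.card : ℝ) ^ c) ∧
        K * (W.card : ℝ) ^ c ≤ K * (H.card : ℝ) ^ c ∧ HasCut G d W D
          (if (D.card : ℝ) < d / 2 then 0 else D.card - d / 4 + K * (W.card : ℝ) ^ c) := by
      intro W D hWD hW
      have hW' : 3 * (W.card : ℝ) ≤ 2 * H.card + 3 * t := by exact_mod_cast hW
      have hlt : (W.card : ℝ) < H.card := by linarith
      have q1 : K * (W.card : ℝ) ^ c ≤ K * (H.card : ℝ) ^ c :=
        mul_le_mul_of_nonneg_left (Real.rpow_le_rpow (by positivity) hlt.le hc.le) hK0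
      refine ⟨mul_le_mul_of_nonneg_left (rpow_card_le (by positivity) (by norm_num)
        hHpos.le hc.le (by linarith)) hK0, q1, ?_⟩
      exact ih W.card (by exact_mod_cast hlt) W D hWD (by linarith) rfl
    obtain ⟨p1, q1, r1⟩ := child H₁ B₁ g1 k5
    obtain ⟨p2, q2, r2⟩ := child H₂ B₂ g2 k6
    refine (hcut _ _ r1 r2).mono ?_
    have k2' : (B₁.card : ℝ) + B₂.card ≤ B.card + 2 * t := by exact_mod_cast k2
    have k3' : (B₁.card : ℝ) ≤ B.card + t := by exact_mod_cast k3
    have k4' : (B₂.card : ℝ) ≤ B.card + t := by exact_mod_cast k4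
    have m1 := mul_le_mul_of_nonneg_right hK hHc
    have m2 := mul_le_mul_of_nonneg_right hKβ hHc
    split_ifs <;> nlinarith

/-- Recursive dissection of a large region into regions of size about `r`. -/
theorem Encloses.hasCut_of_large {β c K h₀ r A' : ℝ} (hc : 0 < c) (hc1 : c < 1) (hβ : 0 ≤ β)
    (hK : 2 * β + K * (3 / 4 : ℝ) ^ c ≤ K) (hKβ : 3 * β ≤ K) (hG : HasSepProfile G β c)
    (hh₀ : ∀ h : ℝ, h₀ ≤ h → 12 * (β * h ^ c) ≤ h) (hd : 2 * h₀ ≤ d) (hd0 : 0 < d)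
    (hr0 : 0 < r) (hrh : h₀ ≤ r) (hr : 16 * (K * r ^ c) ≤ d) (hA' : 0 ≤ A')
    (hδ : 4 * β ≤ A' * ((3 / 4 : ℝ) ^ (c - 1) - 1)) (hrA : 3 * (A' + K) ≤ r ^ (1 - c))
    (H B : Finset V) (hHB : Encloses G H B) (hH : r ≤ 3 * H.card) :
    HasCut G d H B
      (3 * (A' + K) / r ^ (1 - c) * H.card - A' * (H.card : ℝ) ^ c + B.card) := by
  induction hn : H.card using Nat.strong_induction_on generalizing H B with
  | _ n ih =>
  subst hn
  have hK0 : 0 ≤ K := by linarith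
  have hHpos : (0 : ℝ) < H.card := by linarith
  have hHc : (0 : ℝ) ≤ (H.card : ℝ) ^ c := by positivity
  have hrpos : 0 < r ^ (1 - c) := by positivity
  by_cases hle : (H.card : ℝ) ≤ r
  · have hsmall : 16 * (K * (H.card : ℝ) ^ c) ≤ d := by
      have := mul_le_mul_of_nonneg_left (Real.rpow_le_rpow hHpos.le hle hc.le) hK0
      linarith
    refine (hHB.hasCut_of_small hc hβ hK hKβ hG hh₀ hd hd0 H B hsmall).mono ?_
    have e1 : (H.card : ℝ) ^ c ≤ 3 * H.card / r ^ (1 - c) := by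
      rw [le_div_iff₀ hrpos]
      have h1 : r ^ (1 - c) ≤ 3 * (H.card : ℝ) ^ (1 - c) := by
        calc r ^ (1 - c) ≤ (3 * (H.card : ℝ)) ^ (1 - c) :=
              Real.rpow_le_rpow hr0.le hH (by linarith)
          _ = 3 ^ (1 - c) * (H.card : ℝ) ^ (1 - c) := Real.mul_rpow (by norm_num) hHpos.le
          _ ≤ 3 * (H.card : ℝ) ^ (1 - c) := by
              gcongr
              calc (3 : ℝ) ^ (1 - c) ≤ 3 ^ (1 : ℝ) :=
                    Real.rpow_le_rpow_of_exponent_le (by norm_num) (by linarith)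
                _ = 3 := Real.rpow_one 3
      calc (H.card : ℝ) ^ c * r ^ (1 - c)
          ≤ (H.card : ℝ) ^ c * (3 * (H.card : ℝ) ^ (1 - c)) := by gcongr
        _ = 3 * ((H.card : ℝ) ^ c * (H.card : ℝ) ^ (1 - c)) := by ring
        _ = 3 * H.card := by rw [← Real.rpow_add hHpos]; simp
    have e2 := mul_le_mul_of_nonneg_left e1 (add_nonneg hA' hK0)
    have e3 : (A' + K) * (3 * H.card / r ^ (1 - c)) =
        3 * (A' + K) / r ^ (1 - c) * H.card := by ring
    have hB0 : (0 : ℝ) ≤ B.card := by positivity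
    have hd0' : (0 : ℝ) < d := by exact_mod_cast hd0
    have e4 : 0 ≤ K * (H.card : ℝ) ^ c := by positivity
    split_ifs <;> linarith
  · push Not at hle
    obtain ⟨t, H₁, B₁, H₂, B₂, ht, g1, g2, k1, k2, k3, k4, k5, k6, k7, k8, hcut⟩ :=
      hHB.split (d := d) (hG H)
    have h12 := hh₀ H.card (by linarith)
    have ht0 : (0 : ℝ) ≤ t := by positivity
    have child : ∀ W D : Finset V, Encloses G W D → 3 * W.card ≤ 2 * H.card + 3 * t →
        H.card ≤ 3 * W.card → (W.card : ℝ) * ((3 / 4 : ℝ) ^ (c - 1) * (H.card : ℝ) ^ c) ≤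
          (W.card : ℝ) ^ c * H.card ∧ HasCut G d W D
          (3 * (A' + K) / r ^ (1 - c) * W.card - A' * (W.card : ℝ) ^ c + D.card) := by
      intro W D hWD hW hW2
      have hW' : 3 * (W.card : ℝ) ≤ 2 * H.card + 3 * t := by exact_mod_cast hW
      have hW2' : (H.card : ℝ) ≤ 3 * W.card := by exact_mod_cast hW2
      have hWpos : (0 : ℝ) < W.card := by linarith
      have hlt : (W.card : ℝ) < H.card := by linarith
      refine ⟨?_, ih W.card (by exact_mod_cast hlt) W D hWD (by linarith) rfl⟩
      have h1 : (3 / 4 * (H.card : ℝ)) ^ (c - 1) ≤ (W.card : ℝ) ^ (c - 1) :=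
        Real.rpow_le_rpow_of_nonpos hWpos (by linarith) (by linarith)
      rw [Real.mul_rpow (by norm_num) hHpos.le] at h1
      have hp : ∀ x : ℝ, 0 < x → x ^ c = x ^ (c - 1) * x := by
        intro x hx
        rw [Real.rpow_sub_one hx.ne']
        field_simp
      rw [hp _ hHpos, hp _ hWpos]
      calc (W.card : ℝ) * ((3 / 4 : ℝ) ^ (c - 1) * ((H.card : ℝ) ^ (c - 1) * H.card))
          = ((3 / 4 : ℝ) ^ (c - 1) * (H.card : ℝ) ^ (c - 1)) * (W.card * H.card) := by ring
        _ ≤ (W.card : ℝ) ^ (c - 1) * (W.card * H.card) := by gcongr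
        _ = _ := by ring
    obtain ⟨p1, r1⟩ := child H₁ B₁ g1 k5 k7
    obtain ⟨p2, r2⟩ := child H₂ B₂ g2 k6 k8
    refine (hcut _ _ r1 r2).mono ?_
    have k1' : (H₁.card : ℝ) + H₂.card = H.card + t := by exact_mod_cast k1
    have k2' : (B₁.card : ℝ) + B₂.card ≤ B.card + 2 * t := by exact_mod_cast k2
    have hgain : (3 / 4 : ℝ) ^ (c - 1) * (H.card : ℝ) ^ c ≤
        (H₁.card : ℝ) ^ c + (H₂.card : ℝ) ^ c := by
      refine le_of_mul_le_mul_left ?_ hHpos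
      have hX : 0 ≤ (3 / 4 : ℝ) ^ (c - 1) * (H.card : ℝ) ^ c := by positivity
      nlinarith [mul_nonneg ht0 hX]
    have hAt : 3 * (A' + K) / r ^ (1 - c) * t ≤ t := by
      have : 3 * (A' + K) / r ^ (1 - c) ≤ 1 := (div_le_one hrpos).2 hrA
      nlinarith
    have m1 := mul_le_mul_of_nonneg_left hgain hA'
    have m2 := mul_le_mul_of_nonneg_right hδ hHc
    have e : 3 * (A' + K) / r ^ (1 - c) * H₁.card + 3 * (A' + K) / r ^ (1 - c) * H₂.card =
        3 * (A' + K) / r ^ (1 - c) * H.card + 3 * (A' + K) / r ^ (1 - c) * t := by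
      rw [← mul_add, k1', mul_add]
    linarith

end Cut

theorem twelve_mul_rpow_le {β c h : ℝ} (hβ : 0 < β) (hc1 : c < 1)
    (hh : (12 * β) ^ (1 / (1 - c)) ≤ h) : 12 * (β * h ^ c) ≤ h := by
  have hpos : 0 < h := lt_of_lt_of_le (by positivity) hh
  have h1 : 12 * β ≤ h ^ (1 - c) := by
    have := Real.rpow_le_rpow (by positivity) hh (by linarith : 0 ≤ 1 - c)
    rwa [← Real.rpow_mul (by positivity), one_div_mul_cancel (by linarith), Real.rpow_one] at this
  calc 12 * (β * h ^ c) = 12 * β * h ^ c := by ring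
    _ ≤ h ^ (1 - c) * h ^ c := by gcongr
    _ = h := by rw [← Real.rpow_add hpos]; simp

/-- For `β ≥ 1`, `c ∈ (0,1)` there is `α = α(β,c) > 0` such that any graph
on `n ≥ d` vertices with `s_G(r) ≤ β r^c` contains a `d`-correctable set `A` with
`|V ∖ A| ≤ α n / d^{(1−c)/c}`. -/
theorem large_correctable_set (β c : ℝ) (hβ : 1 ≤ β) (hc0 : 0 < c) (hc1 : c < 1) :
    ∃ α : ℝ, 0 < α ∧
      ∀ (V : Type) (_ : Fintype V) (_ : DecidableEq V) (G : SimpleGraph V) (d : ℕ),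
        1 ≤ d → d ≤ Fintype.card V → HasSepProfile G β c →
        ∃ A : Finset V, IsCorrectableSet G d A ∧
          (((Finset.univ \ A).card : ℝ) ≤
            α * (Fintype.card V) / (d : ℝ) ^ ((1 - c) / c)) := by
  have hβ0 : 0 < β := by linarith
  have hσ1 : (3 / 4 : ℝ) ^ c < 1 := Real.rpow_lt_one (by norm_num) (by norm_num) hc0
  have hσ0 : 0 < (3 / 4 : ℝ) ^ c := by positivity
  have hδ : 0 < (3 / 4 : ℝ) ^ (c - 1) - 1 := by
    have := Real.one_lt_rpow_of_pos_of_lt_one_of_neg (x := (3 / 4 : ℝ)) (z := c - 1)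
      (by norm_num) (by norm_num) (by linarith)
    linarith
  obtain ⟨K, hKdef⟩ : ∃ K, K = 3 * β / (1 - (3 / 4 : ℝ) ^ c) := ⟨_, rfl⟩
  have hKeq : K * (1 - (3 / 4 : ℝ) ^ c) = 3 * β := by
    rw [hKdef, div_mul_cancel₀ _ (by linarith)]
  have hK0 : 0 < K := by rw [hKdef]; exact div_pos (by linarith) (by linarith)
  have hK : 2 * β + K * (3 / 4 : ℝ) ^ c ≤ K := by nlinarith
  have hKβ : 3 * β ≤ K := by nlinarith
  obtain ⟨A', hA'def⟩ : ∃ A', A' = 4 * β / ((3 / 4 : ℝ) ^ (c - 1) - 1) := ⟨_, rfl⟩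
  have hA'0 : 0 < A' := by rw [hA'def]; positivity
  have hA' : 4 * β ≤ A' * ((3 / 4 : ℝ) ^ (c - 1) - 1) := by
    rw [hA'def, div_mul_cancel₀ _ hδ.ne']
  set h₀ := (12 * β) ^ (1 / (1 - c)) with hh₀
  have hh₀pos : 0 < h₀ := by positivity
  set R := max h₀ ((3 * (A' + K)) ^ (1 / (1 - c))) with hR
  have hRpos : 0 < R := lt_max_of_lt_left hh₀pos
  set D := max (2 * h₀) (16 * K * R ^ c) with hD
  have hDpos : 0 < D := lt_max_of_lt_left (by linarith)
  set e := (1 - c) / c with he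
  have he0 : 0 < e := div_pos (by linarith) hc0
  refine ⟨D ^ e + 3 * (A' + K) * (16 * K) ^ e, by positivity, ?_⟩
  intro V _ _ G d hd1 _ hG
  have hd0 : (0 : ℝ) < d := by exact_mod_cast hd1
  have hde : 0 < (d : ℝ) ^ e := by positivity
  have hn0 : (0 : ℝ) ≤ Fintype.card V := by positivity
  by_cases hdD : (d : ℝ) < D
  · refine ⟨∅, isCorrectableSet_of_card_lt (by rwa [card_empty]), ?_⟩
    rw [sdiff_empty, card_univ, le_div_iff₀ hde, mul_comm]
    refine mul_le_mul_of_nonneg_right ?_ hn0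
    have h1 : (d : ℝ) ^ e ≤ D ^ e := Real.rpow_le_rpow hd0.le hdD.le he0.le
    have h2 : 0 ≤ 3 * (A' + K) * (16 * K) ^ e := by positivity
    linarith
  push Not at hdD
  obtain ⟨r, hrdef⟩ : ∃ r : ℝ, r = ((d : ℝ) / (16 * K)) ^ (1 / c) := ⟨_, rfl⟩
  have hr0 : 0 < r := by rw [hrdef]; positivity
  have hrc : r ^ c = d / (16 * K) := by
    rw [hrdef, ← Real.rpow_mul (by positivity), one_div_mul_cancel hc0.ne', Real.rpow_one]
  have hr1c : r ^ (1 - c) = (d : ℝ) ^ e / (16 * K) ^ e := by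
    rw [hrdef, ← Real.rpow_mul (by positivity), ← Real.div_rpow (by positivity) (by positivity),
      he]
    congr 1
    ring
  have hr : 16 * (K * r ^ c) = d := by
    rw [hrc]; field_simp
  have hRr : R ≤ r := by
    rw [← Real.rpow_le_rpow_iff hRpos.le hr0.le hc0, hrc, le_div_iff₀ (by positivity)]
    have := (le_max_right (2 * h₀) (16 * K * R ^ c)).trans hdD
    linarith
  have hrA : 3 * (A' + K) ≤ r ^ (1 - c) := by
    have := Real.rpow_le_rpow (by positivity) ((le_max_right _ _).trans hRr)
      (by linarith : 0 ≤ 1 - c)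
    rwa [← Real.rpow_mul (by positivity), one_div_mul_cancel (by linarith), Real.rpow_one] at this
  have hd2 : 2 * h₀ ≤ d := (le_max_left _ _).trans hdD
  have hfun : ∀ h : ℝ, h₀ ≤ h → 12 * (β * h ^ c) ≤ h :=
    fun h hh => twelve_mul_rpow_le hβ0 hc1 hh
  have henc : Encloses G (univ : Finset V) ∅ := ⟨empty_subset _, fun _ _ v _ => mem_univ v⟩
  have hcut : HasCut G d (univ : Finset V) ∅
      (3 * (A' + K) / r ^ (1 - c) * Fintype.card V) := by
    by_cases hbig : r ≤ 3 * ((univ : Finset V).card : ℝ)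
    · refine (henc.hasCut_of_large hc0 hc1 hβ0.le hK hKβ hG hfun hd2 hd1 hr0
        ((le_max_left _ _).trans hRr) hr.le hA'0.le hA' hrA _ _ hbig).mono ?_
      have : 0 ≤ A' * ((univ : Finset V).card : ℝ) ^ c := by positivity
      rw [card_univ] at this ⊢
      simp only [card_empty, Nat.cast_zero]
      linarith
    · push Not at hbig
      have hcn : (0 : ℝ) ≤ (univ : Finset V).card := by positivity
      have h1 : ((univ : Finset V).card : ℝ) ^ c ≤ r ^ c :=
        Real.rpow_le_rpow hcn (by linarith) hc0.le
      have h2 := mul_le_mul_of_nonneg_left h1 hK0.le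
      refine (henc.hasCut_of_small hc0 hβ0.le hK hKβ hG hfun hd2 hd1 _ _
        (by linarith)).mono ?_
      rw [if_pos (by simpa using hd0)]
      positivity
  obtain ⟨S, -, -, hS, hSc⟩ := hcut
  refine ⟨univ \ S, hS, ?_⟩
  rw [sdiff_sdiff_right_self, inf_eq_inter, univ_inter]
  rw [sdiff_empty] at hSc
  refine hSc.trans ?_
  rw [hr1c, div_div_eq_mul_div, div_mul_eq_mul_div]
  gcongr
  have : 0 < D ^ e := by positivity
  linarith
end
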